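/- Let F ⊂ ℝⁿ be a compact convex set of volume 1, let P be a non-constant polynomial on ℝⁿ of degree at most d, and let M(P) be the unique positive number with Vol{x ∈ F : |P(x)| ≥ M(P)} = 1/e. Then the geometric mean of |P| over F satisfies (4e)^{−d} M(P) ≤ exp(∫_F log|P(x)| dx) ≤ 12^d M(P). -/

import Mathlib

open MeasureTheory

open Set Filter Topology in
/-- One-dimensional Brunn-Minkowski inequality for compact sets. -/
lemma volume_add_volume_le_of_isCompact {A B C : Set ℝ} (hA : IsCompact A) (hB : IsCompact B)
    (hA' : A.Nonempty) (hB' : B.Nonempty) (h : ∀ x ∈ A, ∀ y ∈ B, x + y ∈ C) :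
    volume A + volume B ≤ volume C := by
  obtain ⟨a, ha, hamax⟩ := hA.exists_isMaxOn hA' continuousOn_id
  obtain ⟨b, hb, hbmin⟩ := hB.exists_isMinOn hB' continuousOn_id
  have h1 : volume ((fun x => x + b) '' A) = volume A := by
    rw [image_add_right, measure_preimage_add_right]
  have h2 : volume ((fun y => a + y) '' B) = volume B := by
    rw [image_add_left, measure_preimage_add]
  rw [← h1, ← h2, ← measure_union₀]
  · refine measure_mono (union_subset ?_ ?_)
    · rintro _ ⟨x, hx, rfl⟩
      exact h x hx b hb
    · rintro _ ⟨y, hy, rfl⟩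
      exact h a ha y hy
  · exact (hB.image (by fun_prop)).measurableSet.nullMeasurableSet
  · refine measure_mono_null (t := {a + b}) ?_ (by simp)
    rintro _ ⟨⟨x, hx, rfl⟩, ⟨y, hy, hxy⟩⟩
    have hxa : x ≤ a := hamax hx
    have hyb : b ≤ y := hbmin hy
    simp only at hxy
    simp only [mem_singleton_iff]
    linarith

open Set in
/-- One-dimensional Brunn-Minkowski inequality for measurable sets. -/
lemma volume_add_volume_le {A B C : Set ℝ} (hA : MeasurableSet A) (hB : MeasurableSet B)
    (hA' : A.Nonempty) (hB' : B.Nonempty) (h : ∀ x ∈ A, ∀ y ∈ B, x + y ∈ C) :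
    volume A + volume B ≤ volume C := by
  obtain ⟨a, ha⟩ := hA'
  obtain ⟨b, hb⟩ := hB'
  rw [hA.measure_eq_iSup_isCompact, hB.measure_eq_iSup_isCompact]
  simp_rw [iSup_and']
  refine ENNReal.biSup_add_biSup_le' (p := fun K => K ⊆ A ∧ IsCompact K)
    (q := fun K => K ⊆ B ∧ IsCompact K) ⟨∅, empty_subset _, isCompact_empty⟩
    ⟨∅, empty_subset _, isCompact_empty⟩ fun K hK L hL => ?_
  have hKA : insert a K ⊆ A := insert_subset ha hK.1
  have hLB : insert b L ⊆ B := insert_subset hb hL.1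
  calc volume K + volume L ≤ volume (insert a K) + volume (insert b L) :=
        add_le_add (measure_mono (subset_insert _ _)) (measure_mono (subset_insert _ _))
    _ ≤ volume C := volume_add_volume_le_of_isCompact (hK.2.insert a) (hL.2.insert b)
        (insert_nonempty _ _) (insert_nonempty _ _) fun x hx y hy => h x (hKA hx) y (hLB hy)

open Set in
/-- One-dimensional Brunn-Minkowski inequality for convex combinations. -/
lemma volume_convex_comb_le {A B C : Set ℝ} {l : ℝ} (hl0 : 0 < l) (hl1 : l < 1)
    (hA : MeasurableSet A) (hB : MeasurableSet B)
    (hA' : A.Nonempty) (hB' : B.Nonempty) (h : ∀ x ∈ A, ∀ y ∈ B, (1 - l) * x + l * y ∈ C) :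
    ENNReal.ofReal (1 - l) * volume A + ENNReal.ofReal l * volume B ≤ volume C := by
  have key : ∀ (c : ℝ), 0 < c → ∀ S : Set ℝ, volume ((fun x => c⁻¹ * x) ⁻¹' S) =
      ENNReal.ofReal c * volume S := by
    intro c hc S
    rw [Real.volume_preimage_mul_left (by positivity), inv_inv, abs_of_pos hc]
  rw [← key _ (by linarith), ← key _ hl0]
  refine volume_add_volume_le (hA.preimage (by fun_prop)) (hB.preimage (by fun_prop)) ?_ ?_ ?_
  · obtain ⟨a, ha⟩ := hA'
    refine ⟨(1 - l) * a, ?_⟩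
    have : (1 - l) ≠ 0 := by linarith
    simpa [this] using ha
  · obtain ⟨a, ha⟩ := hB'
    refine ⟨l * a, ?_⟩
    simpa [hl0.ne'] using ha
  · intro x hx y hy
    have := h _ hx _ hy
    have h1 : (1 - l) ≠ 0 := by linarith
    rwa [mul_inv_cancel_left₀ h1, mul_inv_cancel_left₀ hl0.ne'] at this

open Set in
/-- Prékopa-Leindler inequality on the line for functions with the same supremum `1`. -/
lemma lintegral_convex_comb_le {f g h : ℝ → ℝ} {l : ℝ} (hl0 : 0 < l) (hl1 : l < 1)
    (hf : Measurable f) (hg : Measurable g) (hh : Measurable h)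
    (hf0 : ∀ x, 0 ≤ f x) (hg0 : ∀ x, 0 ≤ g x) (hh0 : ∀ x, 0 ≤ h x)
    (hf1 : ∀ x, f x ≤ 1) (hg1 : ∀ x, g x ≤ 1)
    (hfs : ∀ t < 1, ∃ x, t < f x) (hgs : ∀ t < 1, ∃ x, t < g x)
    (H : ∀ x y, f x ^ (1 - l) * g y ^ l ≤ h ((1 - l) * x + l * y)) :
    ENNReal.ofReal (1 - l) * (∫⁻ x, ENNReal.ofReal (f x)) +
      ENNReal.ofReal l * (∫⁻ x, ENNReal.ofReal (g x)) ≤ ∫⁻ x, ENNReal.ofReal (h x) := by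
  rw [lintegral_eq_lintegral_meas_lt _ (.of_forall hf0) hf.aemeasurable,
    lintegral_eq_lintegral_meas_lt _ (.of_forall hg0) hg.aemeasurable,
    lintegral_eq_lintegral_meas_lt _ (.of_forall hh0) hh.aemeasurable]
  have hanti : ∀ k : ℝ → ℝ, Measurable fun t : ℝ => volume {a | t < k a} := fun k =>
    Antitone.measurable fun s t hst => measure_mono fun a (ha : t < k a) => hst.trans_lt ha
  rw [← lintegral_const_mul _ (hanti f), ← lintegral_const_mul _ (hanti g),
    ← lintegral_add_left ((hanti f).const_mul _)]
  refine setLIntegral_mono (hanti h) fun t (ht : 0 < t) => ?_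
  rcases lt_or_ge t 1 with ht1 | ht1
  · refine volume_convex_comb_le hl0 hl1 (measurableSet_lt measurable_const hf)
      (measurableSet_lt measurable_const hg) (hfs t ht1) (hgs t ht1) ?_
    intro x (hx : t < f x) y (hy : t < g y)
    refine lt_of_lt_of_le ?_ (H x y)
    calc t = t ^ (1 - l) * t ^ l := by rw [← Real.rpow_add ht]; simp
      _ < f x ^ (1 - l) * g y ^ l := by
        refine mul_lt_mul'' ?_ ?_ (by positivity) (by positivity)
        · exact Real.rpow_lt_rpow ht.le hx (by linarith)
        · exact Real.rpow_lt_rpow ht.le hy hl0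
  · have e1 : {a | t < f a} = ∅ := by
      ext a; simpa using (hf1 a).trans ht1
    have e2 : {a | t < g a} = ∅ := by
      ext a; simpa using (hg1 a).trans ht1
    simp [e1, e2]

open Set in
/-- Prékopa-Leindler inequality on the line. -/
lemma prekopa_leindler_real {f g h : ℝ → ℝ} {l : ℝ} (hl0 : 0 < l) (hl1 : l < 1)
    (hf : Measurable f) (hg : Measurable g) (hh : Measurable h)
    (hf0 : ∀ x, 0 ≤ f x) (hg0 : ∀ x, 0 ≤ g x) (hh0 : ∀ x, 0 ≤ h x)
    (hfb : BddAbove (range f)) (hgb : BddAbove (range g))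
    (hfi : Integrable f) (hgi : Integrable g) (hhi : Integrable h)
    (H : ∀ x y, f x ^ (1 - l) * g y ^ l ≤ h ((1 - l) * x + l * y)) :
    (∫ x, f x) ^ (1 - l) * (∫ x, g x) ^ l ≤ ∫ x, h x := by
  set a := sSup (range f) with ha
  set b := sSup (range g) with hb
  have hfa : ∀ x, f x ≤ a := fun x => le_csSup hfb ⟨x, rfl⟩
  have hgb' : ∀ x, g x ≤ b := fun x => le_csSup hgb ⟨x, rfl⟩
  have hhint : 0 ≤ ∫ x, h x := integral_nonneg hh0
  rcases (hf0 0 |>.trans (hfa 0)).eq_or_lt with ha0 | ha0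
  · have : f = 0 := funext fun x => le_antisymm ((hfa x).trans_eq ha0.symm) (hf0 x)
    simpa [this, Real.zero_rpow (show 1 - l ≠ 0 by linarith)] using hhint
  rcases (hg0 0 |>.trans (hgb' 0)).eq_or_lt with hb0 | hb0
  · have : g = 0 := funext fun x => le_antisymm ((hgb' x).trans_eq hb0.symm) (hg0 x)
    simpa [this, Real.zero_rpow hl0.ne'] using hhint
  set c := a ^ (1 - l) * b ^ l with hc
  have hc0 : 0 < c := by positivity
  have key := lintegral_convex_comb_le (f := fun x => f x / a) (g := fun x => g x / b)
    (h := fun x => h x / c) hl0 hl1 (by fun_prop) (by fun_prop) (by fun_prop)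
    (fun x => div_nonneg (hf0 x) ha0.le) (fun x => div_nonneg (hg0 x) hb0.le)
    (fun x => div_nonneg (hh0 x) hc0.le) (fun x => (div_le_one ha0).2 (hfa x))
    (fun x => (div_le_one hb0).2 (hgb' x)) ?_ ?_ ?_
  · rw [← ofReal_integral_eq_lintegral_ofReal (hfi.div_const _)
        (.of_forall fun x => div_nonneg (hf0 x) ha0.le),
      ← ofReal_integral_eq_lintegral_ofReal (hgi.div_const _)
        (.of_forall fun x => div_nonneg (hg0 x) hb0.le),
      ← ofReal_integral_eq_lintegral_ofReal (hhi.div_const _)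
        (.of_forall fun x => div_nonneg (hh0 x) hc0.le),
      ← ENNReal.ofReal_mul (by linarith), ← ENNReal.ofReal_mul hl0.le, integral_div,
      integral_div, integral_div] at key
    have hF : 0 ≤ ∫ x, f x := integral_nonneg hf0
    have hG : 0 ≤ ∫ x, g x := integral_nonneg hg0
    rw [← ENNReal.ofReal_add (mul_nonneg (by linarith) (by positivity)) (by positivity),
      ENNReal.ofReal_le_ofReal_iff (by positivity)] at key
    have amgm := Real.geom_mean_le_arith_mean2_weighted (w₁ := 1 - l) (w₂ := l)
      (p₁ := (∫ x, f x) / a) (p₂ := (∫ x, g x) / b) (by linarith) hl0.le (by positivity)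
      (by positivity) (by ring)
    have := amgm.trans key
    rw [Real.div_rpow hF ha0.le, Real.div_rpow hG hb0.le, div_mul_div_comm,
      div_le_div_iff_of_pos_right hc0] at this
    exact this
  · intro t ht
    obtain ⟨_, ⟨x, rfl⟩, hx⟩ := exists_lt_of_lt_csSup (range_nonempty f)
      (show t * a < sSup (range f) by rw [← ha]; nlinarith)
    exact ⟨x, by rwa [lt_div_iff₀ ha0]⟩
  · intro t ht
    obtain ⟨_, ⟨x, rfl⟩, hx⟩ := exists_lt_of_lt_csSup (range_nonempty g)
      (show t * b < sSup (range g) by rw [← hb]; nlinarith)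
    exact ⟨x, by rwa [lt_div_iff₀ hb0]⟩
  · intro x y
    rw [Real.div_rpow (hf0 x) ha0.le, Real.div_rpow (hg0 y) hb0.le, div_mul_div_comm,
      div_le_div_iff_of_pos_right hc0]
    exact H x y

open Set in
/-- Multiplicative Brunn-Minkowski inequality for compact sets. -/
lemma brunn_minkowski_pi {l : ℝ} (hl0 : 0 < l) (hl1 : l < 1) {n : ℕ} {A B C : Set (Fin n → ℝ)}
    (hA : IsCompact A) (hB : IsCompact B) (hC : IsCompact C)
    (h : ∀ x ∈ A, ∀ y ∈ B, (1 - l) • x + l • y ∈ C) :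
    volume.real A ^ (1 - l) * volume.real B ^ l ≤ volume.real C := by
  induction n with
  | zero =>
    rcases A.eq_empty_or_nonempty with rfl | ⟨a, ha⟩
    · simp [Real.zero_rpow (show 1 - l ≠ 0 by linarith)]
    rcases B.eq_empty_or_nonempty with rfl | ⟨b, hb⟩
    · simp [Real.zero_rpow hl0.ne']
    have hA1 : A = univ := Subsingleton.eq_univ_of_nonempty ⟨a, ha⟩
    have hB1 : B = univ := Subsingleton.eq_univ_of_nonempty ⟨b, hb⟩
    have hC1 : C = univ := Subsingleton.eq_univ_of_nonempty ⟨_, h a ha b hb⟩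
    simp [hA1, hB1, hC1, measureReal_def, volume_pi]
  | succ n ih =>
    let S : Set (Fin (n + 1) → ℝ) → ℝ → Set (Fin n → ℝ) := fun A s => {y | Fin.cons s y ∈ A}
    have hcons : ∀ s : ℝ, Continuous fun y : Fin n → ℝ => (Fin.cons s y : Fin (n + 1) → ℝ) :=
      fun s => by fun_prop
    have hSsub : ∀ A s, S A s ⊆ (fun x : Fin (n + 1) → ℝ => Fin.tail x) '' A := fun A s y hy =>
      ⟨_, hy, by simp⟩
    have htail : ∀ {A}, IsCompact A → IsCompact ((fun x : Fin (n + 1) → ℝ => Fin.tail x) '' A) :=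
      fun hA => hA.image (by unfold Fin.tail; fun_prop)
    have hS : ∀ {A}, IsCompact A → ∀ s, IsCompact (S A s) := fun hA s =>
      (htail hA).of_isClosed_subset (hA.isClosed.preimage (hcons s)) (hSsub _ s)
    let e := MeasurableEquiv.piFinSuccAbove (fun _ : Fin (n + 1) => ℝ) 0
    have he := volume_preserving_piFinSuccAbove (fun _ : Fin (n + 1) => ℝ) 0
    have hSe : ∀ A s, Prod.mk s ⁻¹' (e.symm ⁻¹' A) = S A s := by
      intro A s
      ext y
      simp [S, e, MeasurableEquiv.piFinSuccAbove, Fin.insertNthEquiv]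
    have hvol : ∀ {A}, IsCompact A → volume A = ∫⁻ s, volume (S A s) := by
      intro A hA
      rw [← (he.symm e).measure_preimage hA.measurableSet.nullMeasurableSet]
      rw [Measure.volume_eq_prod, Measure.prod_apply (e.symm.measurable hA.measurableSet)]
      simp_rw [hSe]
    have hmeas : ∀ {A}, IsCompact A → Measurable fun s => volume (S A s) := by
      intro A hA
      simp_rw [← hSe]
      exact measurable_measure_prodMk_left (e.symm.measurable hA.measurableSet)
    have hint : ∀ {A}, IsCompact A → Integrable fun s => volume.real (S A s) := by
      intro A hA
      refine integrable_toReal_of_lintegral_ne_top (hmeas hA).aemeasurable ?_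
      rw [← hvol hA]
      exact hA.measure_lt_top.ne
    have hvolr : ∀ {A}, IsCompact A → volume.real A = ∫ s, volume.real (S A s) := by
      intro A hA
      rw [measureReal_def, hvol hA]
      exact (integral_toReal (hmeas hA).aemeasurable
        (.of_forall fun s => (hS hA s).measure_lt_top)).symm
    have hbdd : ∀ {A}, IsCompact A → BddAbove (range fun s => volume.real (S A s)) := by
      intro A hA
      refine ⟨volume.real ((fun x : Fin (n + 1) → ℝ => Fin.tail x) '' A), ?_⟩
      rintro _ ⟨s, rfl⟩
      exact measureReal_mono (hSsub A s) (htail hA).measure_lt_top.ne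
    rw [hvolr hA, hvolr hB, hvolr hC]
    refine prekopa_leindler_real hl0 hl1 (hmeas hA).ennreal_toReal (hmeas hB).ennreal_toReal
      (hmeas hC).ennreal_toReal (fun _ => measureReal_nonneg) (fun _ => measureReal_nonneg)
      (fun _ => measureReal_nonneg) (hbdd hA) (hbdd hB) (hint hA) (hint hB) (hint hC) ?_
    intro s t
    refine ih (hS hA s) (hS hB t) (hS hC _) fun x hx y hy => ?_
    have := h _ hx _ hy
    change (Fin.cons _ _ : Fin (n + 1) → ℝ) ∈ C
    convert this using 1
    ext i
    refine Fin.cases ?_ (fun i => ?_) i <;> simp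

/-- Multiplicative Brunn-Minkowski inequality for compact sets. -/
lemma brunn_minkowski {l : ℝ} (hl0 : 0 < l) (hl1 : l < 1) {n : ℕ}
    {A B C : Set (EuclideanSpace ℝ (Fin n))}
    (hA : IsCompact A) (hB : IsCompact B) (hC : IsCompact C)
    (h : ∀ x ∈ A, ∀ y ∈ B, (1 - l) • x + l • y ∈ C) :
    volume.real A ^ (1 - l) * volume.real B ^ l ≤ volume.real C := by
  have hv : ∀ {A : Set (EuclideanSpace ℝ (Fin n))}, IsCompact A →
      volume.real A = volume.real (WithLp.toLp 2 ⁻¹' A) ∧ IsCompact (WithLp.toLp 2 ⁻¹' A) := by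
    intro A hA
    refine ⟨?_, ?_⟩
    · rw [measureReal_def, measureReal_def, (PiLp.volume_preserving_toLp (Fin n)).measure_preimage
        hA.measurableSet.nullMeasurableSet]
    · exact (PiLp.homeomorph 2 _).symm.isCompact_preimage.2 hA
  rw [(hv hA).1, (hv hB).1, (hv hC).1]
  exact brunn_minkowski_pi hl0 hl1 (hv hA).2 (hv hB).2 (hv hC).2 fun x hx y hy => by
    simpa using h _ hx _ hy

lemma rpow_add_le_of_mul_rpow_le {x y p q l : ℝ} (hl0 : 0 < l) (hl1 : l < 1)
    (hp0 : 0 ≤ p) (hq0 : 0 ≤ q) (hpx : p ≤ x) (hqy : q ≤ y) (hxy : x + y ≤ 1)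
    (hp : p ^ l * (1 - y) ^ (1 - l) ≤ x) (hq : q ^ l * (1 - x) ^ (1 - l) ≤ y) :
    (p + q) ^ l ≤ x + y := by
  have key : ∀ {p x y : ℝ}, 0 ≤ p → p ≤ x → 0 ≤ y → x + y ≤ 1 →
      p ^ l * (1 - y) ^ (1 - l) ≤ x → p ≤ x * (x + y) ^ ((1 - l) / l) := by
    intro p x y hp0 hpx hy0 hxy hp
    rcases (hp0.trans hpx).eq_or_lt with hx | hx
    · rw [← hx] at hpx ⊢
      simpa using hpx
    have hw : 0 < x + y := by linarith
    have h1 : x / (x + y) ≤ 1 - y := by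
      rw [div_le_iff₀ hw]
      nlinarith
    have h2 : p ^ l * (x / (x + y)) ^ (1 - l) ≤ x := le_trans (mul_le_mul_of_nonneg_left
      (Real.rpow_le_rpow (by positivity) h1 (by linarith)) (by positivity)) hp
    have h3 : p ^ l ≤ (x * (x + y) ^ ((1 - l) / l)) ^ l := by
      rw [Real.mul_rpow hx.le (by positivity), ← Real.rpow_mul hw.le, div_mul_cancel₀ _ hl0.ne']
      rw [Real.div_rpow hx.le hw.le, mul_div_assoc', div_le_iff₀ (by positivity)] at h2
      have h4 : x = x ^ l * x ^ (1 - l) := by rw [← Real.rpow_add hx]; simp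
      have h5 : p ^ l * x ^ (1 - l) ≤ x ^ l * (x + y) ^ (1 - l) * x ^ (1 - l) := by
        calc _ ≤ x * (x + y) ^ (1 - l) := h2
          _ = x ^ l * x ^ (1 - l) * (x + y) ^ (1 - l) := by rw [← h4]
          _ = _ := by ring
      exact le_of_mul_le_mul_right h5 (by positivity)
    exact (Real.rpow_le_rpow_iff hp0 (by positivity) hl0).1 h3
  have hx0 := hp0.trans hpx
  have hy0 := hq0.trans hqy
  have h1 := key hp0 hpx hy0 hxy hp
  have h2 := key hq0 hqy hx0 (by linarith) hq
  rw [add_comm y x] at h2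
  rcases (add_nonneg hx0 hy0).eq_or_lt with hw | hw
  · have : p + q = 0 := by linarith
    rw [this, Real.zero_rpow hl0.ne', ← hw]
  have h3 : p + q ≤ (x + y) ^ (1 / l) := by
    calc p + q ≤ (x + y) * (x + y) ^ ((1 - l) / l) := by linarith
      _ = (x + y) ^ (1 / l) := by
        rw [← Real.rpow_one_add' hw.le (by
          have : 0 < (1 - l) / l := div_pos (by linarith) hl0
          linarith)]
        congr 1
        field_simp
        ring
  calc (p + q) ^ l ≤ ((x + y) ^ (1 / l)) ^ l := Real.rpow_le_rpow (by linarith) h3 hl0.le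
    _ = x + y := by rw [← Real.rpow_mul hw.le, one_div_mul_cancel hl0.ne', Real.rpow_one]

open Set Filter Topology in
/-- A nonnegative function with null level sets has quantiles of every order. -/
lemma exists_measureReal_ge_eq {ν : Measure ℝ} [IsProbabilityMeasure ν] {Z : ℝ → ℝ}
    (hZ : Measurable Z) (hZ0 : ∀ t, 0 ≤ Z t) (hnull : ∀ r, ν {t | Z t = r} = 0) {a : ℝ}
    (ha0 : 0 < a) (ha1 : a < 1) : ∃ r, 0 < r ∧ ν.real {t | r ≤ Z t} = a := by
  set G : ℝ → ℝ := fun r => ν.real {t | r ≤ Z t} with hG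
  have hms : ∀ r, MeasurableSet {t | r ≤ Z t} := fun r => measurableSet_le measurable_const hZ
  have hGint : ∀ r, G r = ∫ t, indicator {t | r ≤ Z t} (fun _ => (1 : ℝ)) t ∂ν := fun r => by
    rw [integral_indicator (hms r)]; simp [hG]
  have hbd : ∀ r t, ‖indicator {t | r ≤ Z t} (fun _ => (1 : ℝ)) t‖ ≤ 1 := by
    intro r t
    by_cases h : r ≤ Z t <;> simp [indicator, h]
  have hcont : Continuous G := by
    rw [continuous_iff_continuousAt]
    intro r
    simp_rw [funext hGint]
    refine continuousAt_of_dominated (bound := fun _ => 1) (.of_forall fun s =>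
      (measurable_const.indicator (hms s)).aestronglyMeasurable)
      (.of_forall fun s => .of_forall fun t => hbd s t) (integrable_const _) ?_
    have : ∀ᵐ t ∂ν, Z t ≠ r := by simpa [ae_iff] using hnull r
    filter_upwards [this] with t ht
    rcases lt_or_gt_of_ne ht with h | h
    · refine continuousAt_const.congr (f := fun _ => (0 : ℝ)) ?_
      filter_upwards [lt_mem_nhds h] with s hs
      simp [indicator, hs]
    · refine continuousAt_const.congr (f := fun _ => (1 : ℝ)) ?_
      filter_upwards [gt_mem_nhds h] with s hs
      simp [indicator, hs.le]
  have hlim : Tendsto G atTop (𝓝 0) := by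
    simp_rw [funext hGint]
    have := tendsto_integral_filter_of_dominated_convergence (μ := ν) (l := atTop)
      (F := fun r t => indicator {t | r ≤ Z t} (fun _ => (1 : ℝ)) t) (f := fun _ => 0)
      (fun _ => 1) (.of_forall fun s => (measurable_const.indicator (hms s)).aestronglyMeasurable)
      (.of_forall fun s => .of_forall fun t => hbd s t) (integrable_const _)
      (.of_forall fun t => ?_)
    · simpa using this
    · refine tendsto_const_nhds.congr' ?_
      filter_upwards [eventually_gt_atTop (Z t)] with s hs
      simp [indicator, hs]
  obtain ⟨R, hR0, hR⟩ := ((eventually_gt_atTop 0).and (hlim.eventually_lt_const ha0)).exists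
  have hG0 : G 0 = 1 := by simp [hG, hZ0]
  obtain ⟨r, hr, hra⟩ := intermediate_value_Icc' hR0.le hcont.continuousOn
    (show a ∈ Icc (G R) (G 0) from ⟨hR.le, by rw [hG0]; exact ha1.le⟩)
  refine ⟨r, lt_of_le_of_ne hr.1 ?_, hra⟩
  rintro rfl
  exact ha1.ne (hra.symm.trans hG0)

/-- A measure on the line whose two tails are log-concave functions. -/
structure HasLogConcaveTails (ν : Measure ℝ) : Prop where
  right : ∀ x y l : ℝ, 0 < l → l < 1 →
    ν.real (Set.Ici x) ^ (1 - l) * ν.real (Set.Ici y) ^ l ≤ ν.real (Set.Ici ((1 - l) * x + l * y))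
  left : ∀ x y l : ℝ, 0 < l → l < 1 →
    ν.real (Set.Iic x) ^ (1 - l) * ν.real (Set.Iic y) ^ l ≤ ν.real (Set.Iic ((1 - l) * x + l * y))

namespace HasLogConcaveTails

open Set Filter Topology

variable {ν : Measure ℝ} [IsProbabilityMeasure ν] [NullSingletonClass ν]

/-- Dilation inequality for the distance to a real point. -/
lemma dilation_real (hν : HasLogConcaveTails ν) (a : ℝ) {ρ δ : ℝ} (hρ : 0 ≤ ρ) (hδ0 : 0 < δ)
    (hδ1 : δ < 1) :
    ν.real {t | ρ ≤ |t - a|} ^ (2 * δ / (1 + δ)) ≤ ν.real {t | δ * ρ ≤ |t - a|} := by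
  set l := 2 * δ / (1 + δ) with hl
  have hl0 : 0 < l := by positivity
  have hl1 : l < 1 := by rw [hl, div_lt_one (by linarith)]; linarith
  rcases hρ.eq_or_lt with rfl | hρ
  · simp
  have hsplit : ∀ σ : ℝ, 0 < σ → ν.real {t | σ ≤ |t - a|} =
      ν.real (Ici (a + σ)) + ν.real (Iic (a - σ)) := by
    intro σ hσ
    rw [← measureReal_union _ measurableSet_Iic]
    · congr 1
      ext t
      simp only [mem_ofPred_eq, le_abs, mem_union, mem_Ici, mem_Iic]
      constructor <;> rintro (h | h)
      · left; linarith
      · right; linarith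
      · left; linarith
      · right; linarith
    · rw [Set.disjoint_left]
      intro t (h1 : a + σ ≤ t) (h2 : t ≤ a - σ)
      linarith
  have hδρ : δ * ρ < ρ := by nlinarith
  have hδρ0 : 0 < δ * ρ := by positivity
  have hIci : ∀ s, ν.real (Ici s) = 1 - ν.real (Iic s) := by
    intro s
    rw [← probReal_compl_eq_one_sub measurableSet_Iic, compl_Iic]
    exact measureReal_congr Ioi_ae_eq_Ici.symm
  have e1 : (1 - l) * (a - δ * ρ) + l * (a + ρ) = a + δ * ρ := by
    rw [hl]; field_simp; ring
  have e2 : (1 - l) * (a + δ * ρ) + l * (a - ρ) = a - δ * ρ := by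
    rw [hl]; field_simp; ring
  have h1 := hν.right (a - δ * ρ) (a + ρ) l hl0 hl1
  have h2 := hν.left (a + δ * ρ) (a - ρ) l hl0 hl1
  rw [e1, hIci (a - δ * ρ)] at h1
  rw [e2, show ν.real (Iic (a + δ * ρ)) = 1 - ν.real (Ici (a + δ * ρ)) by
    rw [hIci]; ring] at h2
  rw [hsplit _ hρ, hsplit _ hδρ0]
  refine rpow_add_le_of_mul_rpow_le hl0 hl1 measureReal_nonneg measureReal_nonneg
    (measureReal_mono (Ici_subset_Ici.2 (by linarith)))
    (measureReal_mono (Iic_subset_Iic.2 (by linarith))) ?_ (by linarith) (by linarith)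
  rw [← hsplit _ hδρ0]
  exact measureReal_le_one

/-- Dilation inequality for the distance to a complex point. -/
lemma dilation_complex (hν : HasLogConcaveTails ν) (z : ℂ) {ρ δ : ℝ} (hρ : 0 ≤ ρ) (hδ0 : 0 < δ)
    (hδ1 : δ < 1) :
    ν.real {t | ρ ≤ ‖(t : ℂ) - z‖} ^ (2 * δ / (1 + δ)) ≤ ν.real {t | δ * ρ ≤ ‖(t : ℂ) - z‖} := by
  have hsq : ∀ (σ : ℝ) (t : ℝ), 0 ≤ σ →
      (σ ≤ ‖(t : ℂ) - z‖ ↔ σ ^ 2 - z.im ^ 2 ≤ |t - z.re| ^ 2) := by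
    intro σ t hσ
    rw [← sq_le_sq₀ hσ (norm_nonneg _), Complex.sq_norm, Complex.normSq_apply, sq_abs]
    simp
    constructor <;> intro h <;> nlinarith
  rcases le_total (ρ ^ 2) (z.im ^ 2) with h | h
  · have : {t : ℝ | δ * ρ ≤ ‖(t : ℂ) - z‖} = univ := by
      refine eq_univ_of_forall fun t => (hsq _ t (by positivity)).2 ?_
      have h1 : (δ * ρ) ^ 2 ≤ ρ ^ 2 := by
        rw [mul_pow]
        exact mul_le_of_le_one_left (by positivity) (pow_le_one₀ hδ0.le hδ1.le)
      nlinarith [sq_nonneg |t - z.re|]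
    rw [this, probReal_univ]
    exact Real.rpow_le_one measureReal_nonneg measureReal_le_one (by positivity)
  · set σ := √(ρ ^ 2 - z.im ^ 2) with hσ
    have hσ2 : σ ^ 2 = ρ ^ 2 - z.im ^ 2 := Real.sq_sqrt (by linarith)
    have hσ0 : 0 ≤ σ := Real.sqrt_nonneg _
    have e : {t : ℝ | ρ ≤ ‖(t : ℂ) - z‖} = {t | σ ≤ |t - z.re|} := by
      ext t
      rw [mem_ofPred_eq, hsq _ t hρ, ← hσ2, sq_le_sq₀ hσ0 (abs_nonneg _), mem_ofPred_eq]
    rw [e]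
    refine (hν.dilation_real z.re hσ0 hδ0 hδ1).trans (measureReal_mono fun t ht => ?_)
    have ht' : (δ * σ) ^ 2 ≤ |t - z.re| ^ 2 := by
      exact (sq_le_sq₀ (by positivity) (abs_nonneg _)).2 ht
    refine (hsq _ t (by positivity)).2 (le_trans ?_ ht')
    rw [mul_pow, mul_pow, hσ2]
    have : δ ^ 2 ≤ 1 := pow_le_one₀ hδ0.le hδ1.le
    nlinarith [sq_nonneg z.im]

end HasLogConcaveTails

open Set Filter Topology in
lemma setLIntegral_two_mul_exp_neg_div :
    ∫⁻ s in Ioi (0 : ℝ), ENNReal.ofReal (2 * Real.exp (-s) / (1 + Real.exp (-s))) =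
      ENNReal.ofReal (Real.log 4) := by
  have hderiv : ∀ s : ℝ, HasDerivAt (fun s => -2 * Real.log (1 + Real.exp (-s)))
      (2 * Real.exp (-s) / (1 + Real.exp (-s))) s := by
    intro s
    have h1 : HasDerivAt (fun s : ℝ => 1 + Real.exp (-s)) (-Real.exp (-s)) s := by
      simpa using ((hasDerivAt_neg s).exp).const_add 1
    exact ((h1.log (by positivity)).const_mul (-2)).congr_deriv (by ring)
  have hlim : Tendsto (fun s => -2 * Real.log (1 + Real.exp (-s))) atTop (𝓝 0) := by
    have h1 : Tendsto (fun s : ℝ => 1 + Real.exp (-s)) atTop (𝓝 (1 + 0)) :=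
      tendsto_const_nhds.add (Real.tendsto_exp_neg_atTop_nhds_zero)
    have h2 := (h1.log (by norm_num)).const_mul (-2)
    simpa using h2
  have hpos : ∀ s ∈ Ioi (0 : ℝ), 0 ≤ 2 * Real.exp (-s) / (1 + Real.exp (-s)) :=
    fun s _ => by positivity
  have hint := integrableOn_Ioi_deriv_of_nonneg' (fun s _ => hderiv s) hpos hlim
  rw [← ofReal_integral_eq_lintegral_ofReal hint (ae_restrict_of_forall_mem measurableSet_Ioi hpos),
    integral_Ioi_of_hasDerivAt_of_nonneg' (fun s _ => hderiv s) hpos hlim]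
  congr 1
  rw [show (4 : ℝ) = 2 ^ 2 by norm_num, Real.log_pow]
  norm_num

open Set Filter Topology in
lemma setLIntegral_exp_neg_one_sub_half :
    ∫⁻ s in Ioi (0 : ℝ), ENNReal.ofReal (Real.exp (-1 - s / 2)) =
      ENNReal.ofReal (2 * Real.exp (-1)) := by
  have hderiv : ∀ s : ℝ, HasDerivAt (fun s => -2 * Real.exp (-1 - s / 2))
      (Real.exp (-1 - s / 2)) s := by
    intro s
    have h1 : HasDerivAt (fun s : ℝ => -1 - s / 2) (-(1 / 2)) s := by
      simpa using ((hasDerivAt_id s).div_const 2).const_sub (-1)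
    exact (h1.exp.const_mul (-2)).congr_deriv (by ring)
  have hlim : Tendsto (fun s : ℝ => -2 * Real.exp (-1 - s / 2)) atTop (𝓝 0) := by
    have h1 : Tendsto (fun s : ℝ => -1 - s / 2) atTop atBot := by
      refine tendsto_atBot_add_const_left _ (-1) ?_
      exact tendsto_neg_atTop_atBot.comp (tendsto_id.atTop_div_const (by norm_num))
    simpa using (Real.tendsto_exp_atBot.comp h1).const_mul (-2)
  have hpos : ∀ s ∈ Ioi (0 : ℝ), 0 ≤ Real.exp (-1 - s / 2) := fun s _ => by positivity
  have hint := integrableOn_Ioi_deriv_of_nonneg' (fun s _ => hderiv s) hpos hlim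
  rw [← ofReal_integral_eq_lintegral_ofReal hint (ae_restrict_of_forall_mem measurableSet_Ioi hpos),
    integral_Ioi_of_hasDerivAt_of_nonneg' (fun s _ => hderiv s) hpos hlim]
  congr 1
  norm_num

namespace HasLogConcaveTails

open Set Filter Topology

variable {ν : Measure ℝ} [IsProbabilityMeasure ν] [NullSingletonClass ν]

/-- The logarithm of the distance to a complex point, recentred at a quantile, has controlled
positive and negative parts. -/
lemma exists_log_norm_sub_bounds (hν : HasLogConcaveTails ν) (z : ℂ) :
    ∃ r, 0 < r ∧
      ∫⁻ t, ENNReal.ofReal (Real.log (‖(t : ℂ) - z‖ / r)) ∂ν ≤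
        ENNReal.ofReal (3 * Real.exp (-1) ^ 2) ∧
      ∫⁻ t, ENNReal.ofReal (-Real.log (‖(t : ℂ) - z‖ / r)) ∂ν ≤ ENNReal.ofReal (Real.log 4) := by
  have hZ : Measurable fun t : ℝ => ‖(t : ℂ) - z‖ := by fun_prop
  have hnull : ∀ r, ν {t : ℝ | ‖(t : ℂ) - z‖ = r} = 0 := by
    intro r
    refine measure_mono_null (t := {z.re + √(r ^ 2 - z.im ^ 2), z.re - √(r ^ 2 - z.im ^ 2)})
      ?_ (Set.Finite.measure_zero (by simp) _)
    intro t (ht : ‖(t : ℂ) - z‖ = r)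
    have h1 : (t - z.re) ^ 2 = r ^ 2 - z.im ^ 2 := by
      rw [← ht, Complex.sq_norm, Complex.normSq_apply]
      simp
      ring
    rw [← h1, Real.sqrt_sq_eq_abs]
    rcases abs_choice (t - z.re) with h | h <;> rw [h] <;> simp
  obtain ⟨r, hr0, hr⟩ := exists_measureReal_ge_eq (ν := ν) hZ (fun t => norm_nonneg _) hnull
    (Real.exp_pos (-1)) (Real.exp_lt_one_iff.2 (by norm_num))
  refine ⟨r, hr0, ?_, ?_⟩
  · have hms : MeasurableSet {t : ℝ | r ≤ ‖(t : ℂ) - z‖} := measurableSet_le measurable_const hZ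
    have hpt : ∀ t : ℝ, ENNReal.ofReal (Real.log (‖(t : ℂ) - z‖ / r)) ≤
        ENNReal.ofReal (Real.exp (-1)) * (indicator {t : ℝ | r ≤ ‖(t : ℂ) - z‖} 1 t +
          ENNReal.ofReal (max (‖(t : ℂ) - z‖ / r - 1) 0)) := by
      intro t
      by_cases h : r ≤ ‖(t : ℂ) - z‖
      · have h1 : 1 ≤ ‖(t : ℂ) - z‖ / r := (one_le_div hr0).2 h
        rw [indicator_of_mem (by exact h), Pi.one_apply, ← ENNReal.ofReal_one,
          ← ENNReal.ofReal_add (by norm_num) (by positivity), ← ENNReal.ofReal_mul (by positivity)]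
        refine ENNReal.ofReal_le_ofReal ?_
        rw [max_eq_left (by linarith)]
        have h2 := Real.log_le_sub_one_of_pos (x := Real.exp (-1) * (‖(t : ℂ) - z‖ / r))
          (by positivity)
        rw [Real.log_mul (by positivity) (by positivity), Real.log_exp] at h2
        linarith
      · rw [ENNReal.ofReal_of_nonpos]
        · exact zero_le
        · refine Real.log_nonpos (by positivity) ((div_le_one hr0).2 (by linarith))
    have htail : ∫⁻ t : ℝ, ENNReal.ofReal (max (‖(t : ℂ) - z‖ / r - 1) 0) ∂ν ≤
        ENNReal.ofReal (2 * Real.exp (-1)) := by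
      rw [lintegral_eq_lintegral_meas_lt (f := fun t : ℝ => max (‖(t : ℂ) - z‖ / r - 1) 0) _
        (.of_forall fun t => le_max_right _ _) (by fun_prop), ← setLIntegral_exp_neg_one_sub_half]
      refine setLIntegral_mono (by fun_prop) fun s (hs : 0 < s) => ?_
      rw [← ofReal_measureReal (h := measure_ne_top _ _)]
      refine ENNReal.ofReal_le_ofReal ?_
      have hsub : {t : ℝ | s < max (‖(t : ℂ) - z‖ / r - 1) 0} ⊆
          {t : ℝ | (1 + s) * r ≤ ‖(t : ℂ) - z‖} := by
        intro t (ht : s < max (‖(t : ℂ) - z‖ / r - 1) 0)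
        rcases lt_max_iff.1 ht with h | h
        · rw [lt_sub_iff_add_lt, lt_div_iff₀ hr0] at h
          change (1 + s) * r ≤ ‖(t : ℂ) - z‖
          linarith
        · exact absurd h hs.not_gt
      refine (measureReal_mono hsub).trans ?_
      have hd := hν.dilation_complex z (ρ := (1 + s) * r) (δ := 1 / (1 + s)) (by positivity)
        (by positivity) (by rw [div_lt_one] <;> linarith)
      rw [← mul_assoc, one_div_mul_cancel (by positivity), one_mul, hr] at hd
      have e : 2 * (1 / (1 + s)) / (1 + 1 / (1 + s)) = (1 + s / 2)⁻¹ := by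
        field_simp
        ring
      rw [e] at hd
      calc ν.real {t : ℝ | (1 + s) * r ≤ ‖(t : ℂ) - z‖}
          = (ν.real {t : ℝ | (1 + s) * r ≤ ‖(t : ℂ) - z‖} ^ (1 + s / 2)⁻¹) ^ (1 + s / 2) := by
            rw [← Real.rpow_mul measureReal_nonneg, inv_mul_cancel₀ (by positivity), Real.rpow_one]
        _ ≤ Real.exp (-1) ^ (1 + s / 2) :=
            Real.rpow_le_rpow (by positivity) hd (by positivity)
        _ = Real.exp (-1 - s / 2) := by
            rw [← Real.exp_mul]
            congr 1
            ring
    calc _ ≤ _ := lintegral_mono hpt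
      _ = ENNReal.ofReal (Real.exp (-1)) * (ν {t : ℝ | r ≤ ‖(t : ℂ) - z‖} +
          ∫⁻ t : ℝ, ENNReal.ofReal (max (‖(t : ℂ) - z‖ / r - 1) 0) ∂ν) := by
        have hm : Measurable fun t : ℝ => ENNReal.ofReal (max (‖(t : ℂ) - z‖ / r - 1) 0) := by
          fun_prop
        have hi : Measurable (indicator {t : ℝ | r ≤ ‖(t : ℂ) - z‖} (1 : ℝ → ENNReal)) :=
          measurable_one.indicator hms
        rw [← lintegral_indicator_one hms, ← lintegral_add_left hi]
        exact lintegral_const_mul _ (hi.add hm)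
      _ ≤ ENNReal.ofReal (Real.exp (-1)) * (ENNReal.ofReal (Real.exp (-1)) +
          ENNReal.ofReal (2 * Real.exp (-1))) := by
        gcongr
        rw [← ofReal_measureReal (h := measure_ne_top _ _), hr]
      _ = _ := by
        rw [← ENNReal.ofReal_add (by positivity) (by positivity),
          ← ENNReal.ofReal_mul (by positivity)]
        congr 1
        ring
  · calc ∫⁻ t : ℝ, ENNReal.ofReal (-Real.log (‖(t : ℂ) - z‖ / r)) ∂ν
        = ∫⁻ t : ℝ, ENNReal.ofReal (max (-Real.log (‖(t : ℂ) - z‖ / r)) 0) ∂ν := by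
          simp
      _ ≤ ENNReal.ofReal (Real.log 4) := by
          rw [lintegral_eq_lintegral_meas_lt
            (f := fun t : ℝ => max (-Real.log (‖(t : ℂ) - z‖ / r)) 0) _
            (.of_forall fun t => le_max_right _ _) (by fun_prop),
          ← setLIntegral_two_mul_exp_neg_div]
          refine setLIntegral_mono (by fun_prop) fun s (hs : 0 < s) => ?_
          rw [← ofReal_measureReal (h := measure_ne_top _ _)]
          refine ENNReal.ofReal_le_ofReal ?_
          have hsub : {t : ℝ | s < max (-Real.log (‖(t : ℂ) - z‖ / r)) 0} ⊆
              {t : ℝ | Real.exp (-s) * r ≤ ‖(t : ℂ) - z‖}ᶜ := by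
            intro t (ht : s < max (-Real.log (‖(t : ℂ) - z‖ / r)) 0)
            rcases lt_max_iff.1 ht with h | h
            · intro (h1 : Real.exp (-s) * r ≤ ‖(t : ℂ) - z‖)
              rw [← le_div_iff₀ hr0] at h1
              have := Real.log_le_log (Real.exp_pos _) h1
              rw [Real.log_exp] at this
              linarith
            · exact absurd h hs.not_gt
          refine (measureReal_mono hsub).trans ?_
          rw [probReal_compl_eq_one_sub (measurableSet_le measurable_const hZ)]
          have hd := hν.dilation_complex z hr0.le (Real.exp_pos (-s))
            (Real.exp_lt_one_iff.2 (by linarith))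
          rw [hr, ← Real.exp_mul] at hd
          have := Real.add_one_le_exp (-1 * (2 * Real.exp (-s) / (1 + Real.exp (-s))))
          linarith

/-- The logarithm of the distance to a complex point is, up to a constant, a difference of
nonnegative functions with controlled integrals. -/
lemma exists_log_norm_sub_decomposition (hν : HasLogConcaveTails ν) (z : ℂ) :
    ∃ (c : ℝ) (u v : ℝ → ℝ), Integrable u ν ∧ Integrable v ν ∧ (∀ t, 0 ≤ u t) ∧ (∀ t, 0 ≤ v t) ∧
      ∫ t, u t ∂ν ≤ 3 * Real.exp (-1) ^ 2 ∧ ∫ t, v t ∂ν ≤ Real.log 4 ∧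
      ∀ t : ℝ, (t : ℂ) ≠ z → Real.log ‖(t : ℂ) - z‖ = c + u t - v t := by
  obtain ⟨r, hr, hu, hv⟩ := hν.exists_log_norm_sub_bounds z
  have hm : Measurable fun t : ℝ => Real.log (‖(t : ℂ) - z‖ / r) := by fun_prop
  have key : ∀ (g : ℝ → ℝ) (C : ℝ), 0 ≤ C → Measurable g →
      ∫⁻ t, ENNReal.ofReal (g t) ∂ν ≤ ENNReal.ofReal C →
      Integrable (fun t => max (g t) 0) ν ∧ ∫ t, max (g t) 0 ∂ν ≤ C := by
    intro g C hC hg h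
    have h0 : 0 ≤ᵐ[ν] fun t => max (g t) 0 := .of_forall fun t => le_max_right _ _
    have e : ∫⁻ t, ENNReal.ofReal (max (g t) 0) ∂ν = ∫⁻ t, ENNReal.ofReal (g t) ∂ν := by simp
    constructor
    · refine (lintegral_ofReal_ne_top_iff_integrable (by fun_prop) h0).1 ?_
      rw [e]
      exact ne_top_of_le_ne_top ENNReal.ofReal_ne_top h
    · rw [integral_eq_lintegral_of_nonneg_ae h0 (by fun_prop), e]
      exact ENNReal.toReal_le_of_le_ofReal hC h
  obtain ⟨iu, bu⟩ := key _ _ (by positivity) hm hu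
  obtain ⟨iv, bv⟩ := key _ _ (Real.log_nonneg (by norm_num)) hm.neg hv
  refine ⟨Real.log r, _, _, iu, iv, fun t => le_max_right _ _, fun t => le_max_right _ _, bu, bv,
    fun t ht => ?_⟩
  have hpos : 0 < ‖(t : ℂ) - z‖ := norm_pos_iff.2 (sub_ne_zero.2 ht)
  have h1 : Real.log ‖(t : ℂ) - z‖ = Real.log r + Real.log (‖(t : ℂ) - z‖ / r) := by
    rw [Real.log_div hpos.ne' hr.ne']
    ring
  rw [h1]
  have h2 := max_zero_sub_max_neg_zero_eq_self (Real.log (‖(t : ℂ) - z‖ / r))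
  simp only [Pi.neg_apply]
  linarith

/-- The logarithm of a product of distances is, up to a constant, a difference of nonnegative
functions with controlled integrals. -/
lemma exists_log_norm_prod_decomposition (hν : HasLogConcaveTails ν) (s : Multiset ℂ) :
    ∃ (c : ℝ) (u v : ℝ → ℝ), Integrable u ν ∧ Integrable v ν ∧ (∀ t, 0 ≤ u t) ∧ (∀ t, 0 ≤ v t) ∧
      ∫ t, u t ∂ν ≤ s.card * (3 * Real.exp (-1) ^ 2) ∧ ∫ t, v t ∂ν ≤ s.card * Real.log 4 ∧
      ∀ t : ℝ, (t : ℂ) ∉ s →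
        Real.log ‖(s.map fun z => (t : ℂ) - z).prod‖ = c + u t - v t := by
  induction s using Multiset.induction_on with
  | empty => exact ⟨0, fun _ => 0, fun _ => 0, by simp⟩
  | cons z s ih =>
    obtain ⟨c, u, v, iu, iv, u0, v0, bu, bv, h⟩ := ih
    obtain ⟨c', u', v', iu', iv', u0', v0', bu', bv', h'⟩ :=
      hν.exists_log_norm_sub_decomposition z
    refine ⟨c' + c, fun t => u' t + u t, fun t => v' t + v t, iu'.add iu, iv'.add iv,
      fun t => add_nonneg (u0' t) (u0 t), fun t => add_nonneg (v0' t) (v0 t), ?_, ?_, ?_⟩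
    · rw [integral_add iu' iu, Multiset.card_cons]
      push_cast
      linarith
    · rw [integral_add iv' iv, Multiset.card_cons]
      push_cast
      linarith
    · intro t ht
      rw [Multiset.mem_cons, not_or] at ht
      rw [Multiset.map_cons, Multiset.prod_cons, norm_mul, Real.log_mul, h t ht.2, h' t ht.1]
      · ring
      · exact norm_ne_zero_iff.2 (sub_ne_zero.2 ht.1)
      · rw [norm_ne_zero_iff, Ne, Multiset.prod_eq_zero_iff, Multiset.mem_map]
        rintro ⟨w, hw, hw'⟩
        exact ht.2 (sub_eq_zero.1 hw' ▸ hw)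

/-- The logarithm of a univariate polynomial is, up to a constant, a difference of nonnegative
functions with controlled integrals. -/
lemma exists_log_abs_eval_decomposition (hν : HasLogConcaveTails ν) {p : Polynomial ℝ}
    (hp : p ≠ 0) {d : ℕ} (hd : p.natDegree ≤ d) :
    ∃ (c : ℝ) (u v : ℝ → ℝ), Integrable u ν ∧ Integrable v ν ∧ (∀ t, 0 ≤ u t) ∧ (∀ t, 0 ≤ v t) ∧
      ∫ t, u t ∂ν ≤ d * (3 * Real.exp (-1) ^ 2) ∧ ∫ t, v t ∂ν ≤ d * Real.log 4 ∧
      ∀ᵐ t ∂ν, p.eval t ≠ 0 ∧ Real.log |p.eval t| = c + u t - v t := by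
  set q := p.map (algebraMap ℝ ℂ) with hq
  have hq0 : q ≠ 0 := (Polynomial.map_ne_zero_iff (algebraMap ℝ ℂ).injective).2 hp
  have hqs : q.Splits := IsAlgClosed.splits q
  have hcard : q.roots.card ≤ d := by
    refine (Polynomial.card_roots' q).trans ?_
    rwa [hq, Polynomial.natDegree_map]
  have hqe : ∀ t : ℝ, q.eval (t : ℂ) = ((p.eval t : ℝ) : ℂ) := fun t => by
    rw [hq]
    exact Polynomial.eval_map_apply (algebraMap ℝ ℂ) t
  obtain ⟨c, u, v, iu, iv, u0, v0, bu, bv, h⟩ := hν.exists_log_norm_prod_decomposition q.roots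
  refine ⟨Real.log ‖q.leadingCoeff‖ + c, u, v, iu, iv, u0, v0, bu.trans ?_, bv.trans ?_, ?_⟩
  · gcongr
  · have : 0 ≤ Real.log 4 := Real.log_nonneg (by norm_num)
    gcongr
  have hfin : ν {t | p.IsRoot t} = 0 := (Polynomial.finite_setOfPred_isRoot hp).measure_zero _
  have hae : ∀ᵐ t ∂ν, p.eval t ≠ 0 := by rw [ae_iff]; simpa using hfin
  filter_upwards [hae] with t ht
  have hmem : (t : ℂ) ∉ q.roots := by
    rw [Polynomial.mem_roots hq0, Polynomial.IsRoot, hqe]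
    exact_mod_cast ht
  refine ⟨ht, ?_⟩
  have e : |p.eval t| = ‖q.leadingCoeff‖ * ‖(q.roots.map fun z => (t : ℂ) - z).prod‖ := by
    rw [← norm_mul, ← hqs.eval_eq_prod_roots, hqe]
    simp
  have hne : |p.eval t| ≠ 0 := abs_ne_zero.2 ht
  rw [e] at hne ⊢
  rw [Real.log_mul (left_ne_zero_of_mul hne) (right_ne_zero_of_mul hne), h t hmem]
  ring

/-- One-dimensional lower bound for the truncated geometric mean of a polynomial. -/
lemma le_integral_log_max_abs_eval (hν : HasLogConcaveTails ν) {p : Polynomial ℝ} {d : ℕ}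
    (hd : p.natDegree ≤ d) {M : ℝ} (hM : 0 < M)
    (h : Real.exp (-1) ≤ ν.real {t | M ≤ |p.eval t|}) {κ : ℝ} (hκ : 0 < κ) :
    Real.log M - d * (1 + Real.log 4) ≤ ∫ t, Real.log (max |p.eval t| κ) ∂ν := by
  have hp : p ≠ 0 := by
    rintro rfl
    have := Real.exp_pos (-1)
    simp [hM.not_ge] at h
    linarith
  obtain ⟨c, u, v, iu, iv, u0, v0, bu, bv, hae⟩ := hν.exists_log_abs_eval_decomposition hp hd
  have hcu : Integrable (fun t => c + u t) ν := (integrable_const c).add iu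
  have hi : Integrable (fun t => c + u t - v t) ν := hcu.sub iv
  have hint : ∫ t, c + u t - v t ∂ν = c + ∫ t, u t ∂ν - ∫ t, v t ∂ν := by
    rw [integral_sub hcu iv, integral_add (integrable_const c) iu]
    simp
  have hmax : ∀ᵐ t ∂ν, max (c + u t - v t) (Real.log κ) = Real.log (max |p.eval t| κ) := by
    filter_upwards [hae] with t ht
    rw [← ht.2]
    exact (Real.strictMonoOn_log.monotoneOn.map_max (abs_pos.2 ht.1) hκ).symm
  have hle : c + ∫ t, u t ∂ν - ∫ t, v t ∂ν ≤ ∫ t, Real.log (max |p.eval t| κ) ∂ν := by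
    rw [← hint, ← integral_congr_ae hmax]
    exact integral_mono hi (hi.sup (integrable_const _)) fun t => le_max_left _ _
  have hlow : (Real.log M - c) * Real.exp (-1) ≤ ∫ t, u t ∂ν := by
    rcases le_total (Real.log M - c) 0 with h0 | h0
    · exact (mul_nonpos_of_nonpos_of_nonneg h0 (by positivity)).trans (integral_nonneg u0)
    have hm : ν.real {t | M ≤ |p.eval t|} ≤ ν.real {t | Real.log M - c ≤ u t} := by
      refine ENNReal.toReal_mono (measure_ne_top _ _) (measure_mono_ae ?_)
      filter_upwards [hae] with t ht (hMt : M ≤ |p.eval t|)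
      change Real.log M - c ≤ u t
      have := Real.log_le_log hM hMt
      linarith [v0 t]
    calc _ ≤ (Real.log M - c) * ν.real {t | Real.log M - c ≤ u t} := by gcongr; exact h.trans hm
      _ ≤ _ := mul_meas_ge_le_integral_of_nonneg (.of_forall u0) iu _
  have he : Real.exp (-1) * Real.exp 1 = 1 := by rw [← Real.exp_add]; simp
  have hlow' : Real.log M - c ≤ Real.exp 1 * ∫ t, u t ∂ν := by
    calc Real.log M - c = Real.exp 1 * ((Real.log M - c) * Real.exp (-1)) := by
          linear_combination (c - Real.log M) * he
      _ ≤ _ := by gcongr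
  have hnum : (Real.exp 1 - 1) * (3 * Real.exp (-1) ^ 2) ≤ 1 := by
    have h1 : Real.exp 1 * Real.exp (-1) ^ 2 = Real.exp (-1) := by
      linear_combination Real.exp (-1) * he
    nlinarith [sq_nonneg (Real.exp (-1) - 1 / 2)]
  have hu2 : (Real.exp 1 - 1) * ∫ t, u t ∂ν ≤ d * 1 := by
    have : 0 ≤ Real.exp 1 - 1 := by linarith [Real.add_one_le_exp (1 : ℝ)]
    calc _ ≤ (Real.exp 1 - 1) * (d * (3 * Real.exp (-1) ^ 2)) := by gcongr
      _ = d * ((Real.exp 1 - 1) * (3 * Real.exp (-1) ^ 2)) := by ring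
      _ ≤ _ := by gcongr
  linarith

/-- One-dimensional upper bound for the truncated geometric mean of a polynomial. -/
lemma integral_log_max_abs_eval_le (hν : HasLogConcaveTails ν) {p : Polynomial ℝ} {d : ℕ}
    (hd : p.natDegree ≤ d) {M : ℝ} (hM : 0 < M)
    (h : 1 - Real.exp (-1) ≤ ν.real {t | |p.eval t| ≤ M}) :
    ∫ t, Real.log (max |p.eval t| M) ∂ν ≤ Real.log M + d * Real.log 12 := by
  have hlog4 : 0 ≤ Real.log 4 := Real.log_nonneg (by norm_num)
  have hlog12 : 0 ≤ Real.log 12 := Real.log_nonneg (by norm_num)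
  have hlog3 : 1 ≤ Real.log 3 := by
    rw [Real.le_log_iff_exp_le (by norm_num)]
    linarith [Real.exp_one_lt_d9]
  have hexp : Real.exp (-1) ≤ 1 / 2 := by
    rw [Real.exp_neg, inv_le_comm₀ (Real.exp_pos _) (by norm_num)]
    linarith [Real.exp_one_gt_d9]
  have hlog : Real.log 4 + 3 * Real.exp (-1) ^ 2 ≤ Real.log 12 := by
    rw [show (12 : ℝ) = 4 * 3 by norm_num, Real.log_mul (by norm_num) (by norm_num)]
    nlinarith [Real.exp_pos (-1)]
  by_cases hp : p = 0
  · subst hp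
    simp only [Polynomial.eval_zero, abs_zero, max_eq_right hM.le, integral_const, probReal_univ,
      one_smul]
    linarith [mul_nonneg (Nat.cast_nonneg (α := ℝ) d) hlog12]
  obtain ⟨c, u, v, iu, iv, u0, v0, bu, bv, hae⟩ := hν.exists_log_abs_eval_decomposition hp hd
  set a := Real.log M - c with ha
  have hpt : ∀ᵐ t ∂ν, Real.log (max |p.eval t| M) = Real.log M + max (u t - v t - a) 0 := by
    filter_upwards [hae] with t ht
    have h0 : 0 < |p.eval t| := abs_pos.2 ht.1
    rcases le_total |p.eval t| M with h1 | h1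
    · have := Real.log_le_log h0 h1
      rw [max_eq_right h1, max_eq_right (by linarith [ht.2]), add_zero]
    · have := Real.log_le_log hM h1
      rw [max_eq_left h1, max_eq_left (by linarith [ht.2]), ht.2]
      linarith
  have iw : Integrable (fun t => max (u t - v t - a) 0) ν :=
    ((iu.sub iv).sub (integrable_const a)).pos_part
  have iM : Integrable (fun _ : ℝ => Real.log M) ν := integrable_const _
  rw [integral_congr_ae hpt, integral_add iM iw]
  simp only [integral_const, probReal_univ, one_smul]
  suffices hs : ∫ t, max (u t - v t - a) 0 ∂ν ≤ ∫ t, u t ∂ν + ∫ t, v t ∂ν by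
    have : (d : ℝ) * (Real.log 4 + 3 * Real.exp (-1) ^ 2) ≤ d * Real.log 12 := by gcongr
    linarith
  rcases le_total 0 a with ha0 | ha0
  · calc _ ≤ ∫ t, u t ∂ν := integral_mono iw iu fun t =>
          max_le (by linarith [v0 t]) (u0 t)
      _ ≤ _ := by linarith [integral_nonneg (μ := ν) (f := v) v0]
  · have hms : MeasurableSet {t | |p.eval t| ≤ M} :=
      measurableSet_le (by fun_prop) measurable_const
    have hB : ∀ᵐ t ∂ν, max (u t - v t - a) 0 ≤
        u t + indicator {t | |p.eval t| ≤ M}ᶜ (fun _ => -a) t := by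
      filter_upwards [hae] with t ht
      by_cases h1 : |p.eval t| ≤ M
      · have := Real.log_le_log (abs_pos.2 ht.1) h1
        rw [indicator_of_notMem (by simpa using h1), max_eq_right (by linarith [ht.2]), add_zero]
        exact u0 t
      · rw [indicator_of_mem (by simpa using h1)]
        exact max_le (by linarith [v0 t]) (by linarith [u0 t])
    have hBi : Integrable (indicator {t | |p.eval t| ≤ M}ᶜ (fun _ => -a)) ν :=
      (integrable_const _).indicator hms.compl
    have hv : -a * ν.real {t | |p.eval t| ≤ M} ≤ ∫ t, v t ∂ν := by
      have hm : ν.real {t | |p.eval t| ≤ M} ≤ ν.real {t | -a ≤ v t} := by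
        refine ENNReal.toReal_mono (measure_ne_top _ _) (measure_mono_ae ?_)
        filter_upwards [hae] with t ht (hMt : |p.eval t| ≤ M)
        change -a ≤ v t
        have := Real.log_le_log (abs_pos.2 ht.1) hMt
        linarith [u0 t]
      calc _ ≤ -a * ν.real {t | -a ≤ v t} := by
            gcongr
            linarith
        _ ≤ _ := mul_meas_ge_le_integral_of_nonneg (.of_forall v0) iv _
    calc _ ≤ ∫ t, u t + indicator {t | |p.eval t| ≤ M}ᶜ (fun _ => -a) t ∂ν :=
          integral_mono_ae iw (iu.add hBi) hB
      _ = ∫ t, u t ∂ν + (1 - ν.real {t | |p.eval t| ≤ M}) * -a := by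
          rw [integral_add iu hBi, integral_indicator_const _ hms.compl,
            probReal_compl_eq_one_sub hms, smul_eq_mul]
      _ ≤ _ := by nlinarith

end HasLogConcaveTails

/-- A level set of a nonzero linear functional has measure zero. -/
lemma volume_linear_level_eq_zero {n : ℕ} {φ : EuclideanSpace ℝ (Fin n) →ₗ[ℝ] ℝ} (hφ : φ ≠ 0)
    (c : ℝ) : volume {x | φ x = c} = 0 := by
  rcases Set.eq_empty_or_nonempty {x | φ x = c} with h | ⟨x₀, hx₀ : φ x₀ = c⟩
  · rw [h, measure_empty]
  · have e : {x | φ x = c} = (fun x => -x₀ + x) ⁻¹' (LinearMap.ker φ : Set _) := by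
      ext x
      simp only [Set.mem_ofPred_eq, Set.mem_preimage, SetLike.mem_coe, LinearMap.mem_ker, map_add,
        map_neg, hx₀]
      constructor <;> intro h <;> linarith
    rw [e, measure_preimage_add]
    exact Measure.addHaar_submodule _ _ (by rwa [Ne, LinearMap.ker_eq_top])

/-- A set on which the localization process operates. -/
structure IsNeedleCandidate {n : ℕ} (f g : EuclideanSpace ℝ (Fin n) → ℝ)
    (K : Set (EuclideanSpace ℝ (Fin n))) : Prop where
  isCompact : IsCompact K
  convex : Convex ℝ K
  integrableOn_left : IntegrableOn f K
  integrableOn_right : IntegrableOn g K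
  integral_eq_zero : ∫ x in K, f x = 0
  integral_neg : ∫ x in K, g x < 0

namespace IsNeedleCandidate

open Set Filter Topology

variable {n : ℕ} {f g : EuclideanSpace ℝ (Fin n) → ℝ} {K : Set (EuclideanSpace ℝ (Fin n))}

/-- One bisection step of the localization process, by a hyperplane containing a prescribed
affine subspace of codimension two. -/
lemma exists_bisection (hK : IsNeedleCandidate f g K) {i j : Fin n} (hij : i ≠ j) (a b : ℝ) :
    ∃ K' ⊆ K, IsNeedleCandidate f g K' ∧
      ∃ s t : ℝ, (s ≠ 0 ∨ t ≠ 0) ∧ ∀ x ∈ K', 0 ≤ s * (x i - a) + t * (x j - b) := by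
  set φ : ℝ → EuclideanSpace ℝ (Fin n) → ℝ :=
    fun θ x => Real.cos θ * (x i - a) + Real.sin θ * (x j - b) with hφ
  have hφx : ∀ θ, Continuous (φ θ) := fun θ => by fun_prop
  have hφθ : ∀ x, Continuous fun θ => φ θ x := fun x => by fun_prop
  have hKm := hK.isCompact.measurableSet
  have hms : ∀ θ, MeasurableSet {x | 0 ≤ φ θ x} := fun θ =>
    (isClosed_le continuous_const (hφx θ)).measurableSet
  have hms' : ∀ θ, MeasurableSet {x | φ θ x ≤ 0} := fun θ =>
    (isClosed_le (hφx θ) continuous_const).measurableSet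
  have hnull : ∀ θ, volume {x | φ θ x = 0} = 0 := by
    intro θ
    let L : EuclideanSpace ℝ (Fin n) →ₗ[ℝ] ℝ :=
      { toFun := fun x => Real.cos θ * x i + Real.sin θ * x j
        map_add' := fun x y => by simp; ring
        map_smul' := fun r x => by simp; ring }
    have hL : L ≠ 0 := by
      intro h
      have h1 : L (EuclideanSpace.single i 1) = 0 := by rw [h]; rfl
      have h2 : L (EuclideanSpace.single j 1) = 0 := by rw [h]; rfl
      simp only [L, LinearMap.coe_mk, AddHom.coe_mk] at h1 h2
      simp [hij, hij.symm] at h1 h2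
      have := Real.sin_sq_add_cos_sq θ
      rw [h1, h2] at this
      norm_num at this
    rw [← volume_linear_level_eq_zero hL (Real.cos θ * a + Real.sin θ * b)]
    congr 1
    ext x
    simp only [hφ, L, LinearMap.coe_mk, AddHom.coe_mk, mem_ofPred_eq]
    constructor <;> intro h <;> linarith
  have hsplit : ∀ (h : EuclideanSpace ℝ (Fin n) → ℝ), IntegrableOn h K → ∀ θ,
      ∫ x in K, h x = (∫ x in K ∩ {x | 0 ≤ φ θ x}, h x) + ∫ x in K ∩ {x | φ θ x ≤ 0}, h x := by
    intro h hh θ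
    have hu : K = K ∩ {x | 0 ≤ φ θ x} ∪ K ∩ {x | φ θ x ≤ 0} := by
      rw [← inter_union_distrib_left]
      refine (inter_eq_left.2 fun x _ => ?_).symm
      exact le_total 0 (φ θ x)
    conv_lhs => rw [hu]
    refine setIntegral_union₀ ?_ (hKm.inter (hms' θ)).nullMeasurableSet
      (hh.mono_set inter_subset_left) (hh.mono_set inter_subset_left)
    refine measure_mono_null ?_ (hnull θ)
    rintro x ⟨⟨_, h1 : 0 ≤ φ θ x⟩, _, h2 : φ θ x ≤ 0⟩
    exact le_antisymm h2 h1
  set I : ℝ → ℝ := fun θ => ∫ x in K ∩ {x | 0 ≤ φ θ x}, f x with hI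
  have hIint : ∀ θ, I θ = ∫ x in K, indicator {x | 0 ≤ φ θ x} f x := fun θ => by
    rw [setIntegral_indicator (hms θ)]
  have hcont : Continuous I := by
    rw [continuous_iff_continuousAt]
    intro θ
    simp_rw [funext hIint]
    refine continuousAt_of_dominated (bound := fun x => ‖f x‖) (.of_forall fun s =>
      hK.integrableOn_left.aestronglyMeasurable.indicator (hms s))
      (.of_forall fun s => .of_forall fun t => norm_indicator_le_norm_self _ _)
      hK.integrableOn_left.norm ?_
    have : ∀ᵐ x ∂volume.restrict K, φ θ x ≠ 0 :=
      ae_restrict_of_ae (by simpa [ae_iff] using hnull θ)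
    filter_upwards [this] with x hx
    rcases lt_or_gt_of_ne hx with h | h
    · refine continuousAt_const.congr (f := fun _ => (0 : ℝ)) ?_
      filter_upwards [(hφθ x).continuousAt.eventually_lt_const h] with s hs
      rw [indicator_of_notMem (by simpa using hs)]
    · refine continuousAt_const.congr (f := fun _ => f x) ?_
      filter_upwards [(hφθ x).continuousAt.eventually_const_lt h] with s hs
      rw [indicator_of_mem (by exact hs.le)]
  have hIsum : I 0 + I Real.pi = 0 := by
    have h1 := hsplit f hK.integrableOn_left 0
    rw [hK.integral_eq_zero] at h1
    have h2 : {x | φ 0 x ≤ 0} = {x | 0 ≤ φ Real.pi x} := by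
      ext x
      simp [hφ]
    rw [h2] at h1
    exact h1.symm
  obtain ⟨θ, hθ⟩ : ∃ θ, I θ = 0 := by
    have : (0 : ℝ) ∈ uIcc (I 0) (I Real.pi) := by
      rw [mem_uIcc]
      rcases le_total (I 0) 0 with h | h
      · left; exact ⟨h, by linarith⟩
      · right; exact ⟨by linarith, h⟩
    obtain ⟨θ, -, hθ⟩ := intermediate_value_uIcc hcont.continuousOn this
    exact ⟨θ, hθ⟩
  have hne : Real.cos θ ≠ 0 ∨ Real.sin θ ≠ 0 := by
    by_contra! h
    have := Real.sin_sq_add_cos_sq θ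
    rw [h.1, h.2] at this
    norm_num at this
  have hf := hsplit f hK.integrableOn_left θ
  rw [hK.integral_eq_zero] at hf
  have hf1 : ∫ x in K ∩ {x | 0 ≤ φ θ x}, f x = 0 := hθ
  have hf2 : ∫ x in K ∩ {x | φ θ x ≤ 0}, f x = 0 := by linarith
  have hg := hsplit g hK.integrableOn_right θ
  have hgneg := hK.integral_neg
  have hcv : ∀ θ, Convex ℝ {x | 0 ≤ φ θ x} := by
    intro θ x (hx : 0 ≤ φ θ x) y (hy : 0 ≤ φ θ y) r s hr hs hrs
    change 0 ≤ φ θ (r • x + s • y)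
    have : φ θ (r • x + s • y) = r * φ θ x + s * φ θ y := by
      simp [hφ]
      linear_combination (-(a * Real.cos θ) - b * Real.sin θ) * -hrs
    rw [this]
    positivity
  have hcand : ∀ S : Set (EuclideanSpace ℝ (Fin n)), IsClosed S → Convex ℝ S →
      ∫ x in K ∩ S, f x = 0 → ∫ x in K ∩ S, g x < 0 → IsNeedleCandidate f g (K ∩ S) :=
    fun S hS hSc h1 h2 => ⟨hK.isCompact.inter_right hS, hK.convex.inter hSc,
      hK.integrableOn_left.mono_set inter_subset_left,
      hK.integrableOn_right.mono_set inter_subset_left, h1, h2⟩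
  rcases lt_or_ge (∫ x in K ∩ {x | 0 ≤ φ θ x}, g x) 0 with h | h
  · exact ⟨_, inter_subset_left, hcand _ (isClosed_le continuous_const (hφx θ)) (hcv θ) hf1 h,
      _, _, hne, fun x hx => hx.2⟩
  · have e : {x | φ θ x ≤ 0} = {x | 0 ≤ φ (θ + Real.pi) x} := by
      ext x
      simp only [hφ, Real.cos_add_pi, Real.sin_add_pi, mem_ofPred_eq]
      constructor <;> intro h <;> linarith
    refine ⟨_, inter_subset_left, hcand _ (isClosed_le (hφx θ) continuous_const)
      (e ▸ hcv (θ + Real.pi)) hf2 (by linarith), -Real.cos θ, -Real.sin θ, by simpa using hne,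
      fun x hx => ?_⟩
    have : φ θ x ≤ 0 := hx.2
    simp only [hφ] at this
    linarith

end IsNeedleCandidate

open Set Filter Topology in
/-- A nondegenerate plane triangle contains a rational point through which no line leaves the
triangle on one side. -/
lemma exists_rat_mem_triangle {x₁ x₂ y₁ y₂ z₁ z₂ : ℝ}
    (hD : (y₁ - x₁) * (z₂ - x₂) - (y₂ - x₂) * (z₁ - x₁) ≠ 0) :
    ∃ a b : ℚ, ∀ s t : ℝ, 0 ≤ s * (x₁ - a) + t * (x₂ - b) → 0 ≤ s * (y₁ - a) + t * (y₂ - b) →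
      0 ≤ s * (z₁ - a) + t * (z₂ - b) → s = 0 ∧ t = 0 := by
  set D := (y₁ - x₁) * (z₂ - x₂) - (y₂ - x₂) * (z₁ - x₁) with hDdef
  let β : ℝ × ℝ → ℝ := fun p => ((p.1 - x₁) * (z₂ - x₂) - (p.2 - x₂) * (z₁ - x₁)) / D
  let γ : ℝ × ℝ → ℝ := fun p => ((y₁ - x₁) * (p.2 - x₂) - (y₂ - x₂) * (p.1 - x₁)) / D
  have hβ : Continuous β := by fun_prop
  have hγ : Continuous γ := by fun_prop
  have hU : IsOpen {p | 0 < β p ∧ 0 < γ p ∧ β p + γ p < 1} :=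
    (isOpen_lt continuous_const hβ).inter ((isOpen_lt continuous_const hγ).inter
      (isOpen_lt (hβ.add hγ) continuous_const))
  have hne : {p | 0 < β p ∧ 0 < γ p ∧ β p + γ p < 1}.Nonempty := by
    refine ⟨((x₁ + y₁ + z₁) / 3, (x₂ + y₂ + z₂) / 3), ?_⟩
    have h1 : β ((x₁ + y₁ + z₁) / 3, (x₂ + y₂ + z₂) / 3) = 1 / 3 := by
      simp only [β]
      rw [div_eq_iff hD]
      ring
    have h2 : γ ((x₁ + y₁ + z₁) / 3, (x₂ + y₂ + z₂) / 3) = 1 / 3 := by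
      simp only [γ]
      rw [div_eq_iff hD]
      ring
    rw [mem_ofPred_eq, h1, h2]
    norm_num
  have hdense : DenseRange (Prod.map ((↑) : ℚ → ℝ) ((↑) : ℚ → ℝ)) :=
    Rat.denseRange_cast.prodMap Rat.denseRange_cast
  obtain ⟨⟨a, b⟩, h0, h1, h2⟩ := hdense.exists_mem_open hU hne
  refine ⟨a, b, fun s t hx hy hz => ?_⟩
  change 0 < β ((a : ℝ), (b : ℝ)) at h0
  change 0 < γ ((a : ℝ), (b : ℝ)) at h1
  change β ((a : ℝ), (b : ℝ)) + γ ((a : ℝ), (b : ℝ)) < 1 at h2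
  have hβe : β ((a : ℝ), (b : ℝ)) * D = (a - x₁) * (z₂ - x₂) - (b - x₂) * (z₁ - x₁) :=
    div_mul_cancel₀ _ hD
  have hγe : γ ((a : ℝ), (b : ℝ)) * D = (y₁ - x₁) * (b - x₂) - (y₂ - x₂) * (a - x₁) :=
    div_mul_cancel₀ _ hD
  generalize β ((a : ℝ), (b : ℝ)) = u at *
  generalize γ ((a : ℝ), (b : ℝ)) = v at *
  have ea : (a : ℝ) - x₁ = u * (y₁ - x₁) + v * (z₁ - x₁) := by
    apply mul_right_cancel₀ hD
    linear_combination -(y₁ - x₁) * hβe - (z₁ - x₁) * hγe + (a - x₁) * hDdef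
  have eb : (b : ℝ) - x₂ = u * (y₂ - x₂) + v * (z₂ - x₂) := by
    apply mul_right_cancel₀ hD
    linear_combination -(y₂ - x₂) * hβe - (z₂ - x₂) * hγe + (b - x₂) * hDdef
  have hsum : (1 - u - v) * (s * (x₁ - a) + t * (x₂ - b)) + u * (s * (y₁ - a) + t * (y₂ - b)) +
      v * (s * (z₁ - a) + t * (z₂ - b)) = 0 := by
    linear_combination -s * ea - t * eb
  have p1 := mul_nonneg (show 0 ≤ 1 - u - v by linarith) hx
  have p2 := mul_nonneg h0.le hy
  have p3 := mul_nonneg h1.le hz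
  have q1 : s * (x₁ - a) + t * (x₂ - b) = 0 :=
    (mul_eq_zero.1 (by linarith : (1 - u - v) * _ = 0)).resolve_left (by linarith)
  have q2 : s * (y₁ - a) + t * (y₂ - b) = 0 :=
    (mul_eq_zero.1 (by linarith : u * _ = 0)).resolve_left h0.ne'
  have q3 : s * (z₁ - a) + t * (z₂ - b) = 0 :=
    (mul_eq_zero.1 (by linarith : v * _ = 0)).resolve_left h1.ne'
  constructor
  · refine (mul_eq_zero.1 (?_ : s * D = 0)).resolve_right hD
    linear_combination s * hDdef + (z₂ - x₂) * (q2 - q1) - (y₂ - x₂) * (q3 - q1)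
  · refine (mul_eq_zero.1 (?_ : t * D = 0)).resolve_right hD
    linear_combination t * hDdef + (y₁ - x₁) * (q3 - q1) - (z₁ - x₁) * (q2 - q1)

open Set Filter Topology in
/-- Sets which lie on one side of a line in every coordinate plane and through every rational point
are contained in a line. -/
lemma exists_line_of_forall_halfspace {n : ℕ} (hn : 0 < n) {K : Set (EuclideanSpace ℝ (Fin n))}
    (hK : ∀ i j : Fin n, i ≠ j → ∀ a b : ℚ, ∃ s t : ℝ, (s ≠ 0 ∨ t ≠ 0) ∧
      ∀ x ∈ K, 0 ≤ s * (x i - a) + t * (x j - b)) :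
    ∃ q e : EuclideanSpace ℝ (Fin n), ‖e‖ = 1 ∧ ∀ x ∈ K, x = q + inner ℝ e (x - q) • e := by
  have hminor : ∀ x ∈ K, ∀ y ∈ K, ∀ z ∈ K, ∀ i j : Fin n,
      (y i - x i) * (z j - x j) - (y j - x j) * (z i - x i) = 0 := by
    intro x hx y hy z hz i j
    by_contra h
    have hij : i ≠ j := by
      rintro rfl
      exact h (by ring)
    obtain ⟨a, b, hab⟩ := exists_rat_mem_triangle h
    obtain ⟨s, t, hst, hK'⟩ := hK i j hij a b
    have := hab s t (hK' x hx) (hK' y hy) (hK' z hz)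
    tauto
  by_cases hsub : K.Subsingleton
  · obtain rfl | ⟨q, rfl⟩ := hsub.eq_empty_or_singleton
    · exact ⟨0, EuclideanSpace.single ⟨0, hn⟩ 1, by simp, by simp⟩
    · exact ⟨q, EuclideanSpace.single ⟨0, hn⟩ 1, by simp, by simp⟩
  rw [not_subsingleton_iff] at hsub
  obtain ⟨q, hq, y, hy, hqy⟩ := hsub
  have hw : y - q ≠ 0 := sub_ne_zero.2 hqy.symm
  have hw' : ‖y - q‖ ≠ 0 := norm_ne_zero_iff.2 hw
  refine ⟨q, ‖y - q‖⁻¹ • (y - q), by rw [norm_smul, norm_inv, norm_norm, inv_mul_cancel₀ hw'],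
    fun x hx => ?_⟩
  obtain ⟨k, hk⟩ : ∃ k, (y - q) k ≠ 0 := by
    by_contra! h
    exact hw (by ext k; exact h k)
  obtain ⟨r, hr⟩ : ∃ r : ℝ, x - q = r • (y - q) := by
    refine ⟨(x k - q k) / (y k - q k), ?_⟩
    ext j
    have := hminor q hq y hy x hx k j
    have hk' : y k - q k ≠ 0 := hk
    simp only [PiLp.sub_apply, PiLp.smul_apply, smul_eq_mul]
    field_simp
    linarith
  rw [hr, real_inner_smul_left, real_inner_smul_right, real_inner_self_eq_norm_sq, smul_smul,
    show ‖y - q‖⁻¹ * (r * ‖y - q‖ ^ 2) * ‖y - q‖⁻¹ = r by field_simp, ← hr]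
  abel

open Set Filter Topology in
/-- Localization: a candidate can be reduced to one contained in a thin neighbourhood of a line. -/
lemma IsNeedleCandidate.exists_thin {n : ℕ} (hn : 0 < n) {f g : EuclideanSpace ℝ (Fin n) → ℝ}
    {F : Set (EuclideanSpace ℝ (Fin n))} (hF : IsNeedleCandidate f g F) {ε : ℝ} (hε : 0 < ε) :
    ∃ K ⊆ F, IsNeedleCandidate f g K ∧ ∃ q e : EuclideanSpace ℝ (Fin n), ‖e‖ = 1 ∧
      ∀ x ∈ K, dist x (q + inner ℝ e (x - q) • e) < ε := by
  have hstep : ∀ (K : {K : Set (EuclideanSpace ℝ (Fin n)) // IsNeedleCandidate f g K})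
      (m : Fin n × Fin n × ℚ × ℚ), ∃ K' : {K : Set (EuclideanSpace ℝ (Fin n)) //
        IsNeedleCandidate f g K}, K'.1 ⊆ K.1 ∧ (m.1 ≠ m.2.1 → ∃ s t : ℝ, (s ≠ 0 ∨ t ≠ 0) ∧
          ∀ x ∈ K'.1, 0 ≤ s * (x m.1 - m.2.2.1) + t * (x m.2.1 - m.2.2.2)) := by
    intro K m
    by_cases h : m.1 = m.2.1
    · exact ⟨K, Subset.rfl, fun h' => absurd h h'⟩
    · obtain ⟨K', h1, h2, h3⟩ := K.2.exists_bisection h m.2.2.1 m.2.2.2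
      exact ⟨⟨K', h2⟩, h1, fun _ => h3⟩
  choose next hnext using hstep
  have : Nonempty (Fin n) := ⟨⟨0, hn⟩⟩
  obtain ⟨enum, henum⟩ := exists_surjective_nat (Fin n × Fin n × ℚ × ℚ)
  let S : ℕ → {K : Set (EuclideanSpace ℝ (Fin n)) // IsNeedleCandidate f g K} :=
    fun k => Nat.rec ⟨F, hF⟩ (fun m K => next K (enum m)) k
  have hanti : Antitone fun k => (S k).1 :=
    antitone_nat_of_succ_le fun k => (hnext (S k) (enum k)).1
  have hline : ∀ i j : Fin n, i ≠ j → ∀ a b : ℚ, ∃ s t : ℝ, (s ≠ 0 ∨ t ≠ 0) ∧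
      ∀ x ∈ ⋂ k, (S k).1, 0 ≤ s * (x i - a) + t * (x j - b) := by
    intro i j hij a b
    obtain ⟨m, hm⟩ := henum (i, j, a, b)
    have h := (hnext (S m) (enum m)).2
    rw [hm] at h
    obtain ⟨s, t, hst, h⟩ := h hij
    refine ⟨s, t, hst, fun x hx => h x ?_⟩
    have := mem_iInter.1 hx (m + 1)
    rwa [show S (m + 1) = next (S m) (enum m) from rfl, hm] at this
  obtain ⟨q, e, he, hqe⟩ := exists_line_of_forall_halfspace hn hline
  have hopen : IsOpen {x | dist x (q + inner ℝ e (x - q) • e) < ε} :=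
    isOpen_lt (by fun_prop) continuous_const
  obtain ⟨k, hk⟩ := exists_subset_nhds_of_isCompact (directed_of_isDirected_le hanti)
    (fun k => (S k).2.isCompact) (U := {x | dist x (q + inner ℝ e (x - q) • e) < ε})
    fun x hx => hopen.mem_nhds (by
      rw [mem_ofPred_eq, ← hqe x hx, dist_self]
      exact hε)
  exact ⟨(S k).1, hanti (Nat.zero_le k), (S k).2, q, e, he, fun x hx => hk hx⟩

/-- The distribution along a line of the uniform probability measure on a set. -/
noncomputable def lineDistribution {n : ℕ} (K : Set (EuclideanSpace ℝ (Fin n)))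
    (q e : EuclideanSpace ℝ (Fin n)) : Measure ℝ :=
  (ProbabilityTheory.cond volume K).map fun x => inner ℝ e (x - q)

namespace lineDistribution

open Set Filter Topology

variable {n : ℕ} {K : Set (EuclideanSpace ℝ (Fin n))} {q e : EuclideanSpace ℝ (Fin n)}

lemma isProbabilityMeasure (hKc : IsCompact K) (hK : volume K ≠ 0) :
    IsProbabilityMeasure (lineDistribution K q e) := by
  have := ProbabilityTheory.cond_isProbabilityMeasure_of_finite hK hKc.measure_lt_top.ne
  exact Measure.isProbabilityMeasure_map (by fun_prop)

lemma real_apply (hKc : IsCompact K) {S : Set ℝ} (hS : MeasurableSet S) :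
    (lineDistribution K q e).real S =
      (volume.real K)⁻¹ * volume.real (K ∩ {x | inner ℝ e (x - q) ∈ S}) := by
  rw [lineDistribution, map_measureReal_apply (by fun_prop) hS,
    measureReal_def, ProbabilityTheory.cond_apply hKc.measurableSet, ENNReal.toReal_mul,
    ENNReal.toReal_inv]
  rfl

lemma nullSingletonClass (hKc : IsCompact K) (he : e ≠ 0) :
    NullSingletonClass (lineDistribution K q e) := by
  refine ⟨fun t => ?_⟩
  rw [lineDistribution, Measure.map_apply (by fun_prop) (measurableSet_singleton t),
    ProbabilityTheory.cond_apply hKc.measurableSet]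
  refine mul_eq_zero_of_right _ (measure_mono_null inter_subset_right ?_)
  have hL : (innerₛₗ ℝ e : EuclideanSpace ℝ (Fin n) →ₗ[ℝ] ℝ) ≠ 0 := fun h => by
    have := LinearMap.congr_fun h e
    simp [he] at this
  rw [← volume_linear_level_eq_zero hL (t + inner ℝ e q)]
  congr 1
  ext x
  simp only [mem_preimage, mem_singleton_iff, mem_ofPred_eq, innerₛₗ_apply_apply, inner_sub_right]
  exact sub_eq_iff_eq_add

lemma hasLogConcaveTails (hKc : IsCompact K) (hKv : Convex ℝ K) :
    HasLogConcaveTails (lineDistribution K q e) := by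
  have key : ∀ S T U : Set ℝ, IsClosed S → IsClosed T → IsClosed U → ∀ l : ℝ, 0 < l → l < 1 →
      (∀ s ∈ S, ∀ t ∈ T, (1 - l) * s + l * t ∈ U) →
      (lineDistribution K q e).real S ^ (1 - l) * (lineDistribution K q e).real T ^ l ≤
        (lineDistribution K q e).real U := by
    intro S T U hS hT hU l hl0 hl1 h
    have hcl : ∀ S : Set ℝ, IsClosed S → IsClosed {x | inner ℝ e (x - q) ∈ S} :=
      fun S hS => hS.preimage (by fun_prop : Continuous fun x => inner ℝ e (x - q))
    rw [real_apply hKc hS.measurableSet, real_apply hKc hT.measurableSet,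
      real_apply hKc hU.measurableSet, Real.mul_rpow (by positivity) measureReal_nonneg,
      Real.mul_rpow (by positivity) measureReal_nonneg]
    set c := (volume.real K)⁻¹
    have hc : c ^ (1 - l) * c ^ l = c := by
      rw [← Real.rpow_add' (by positivity) (by simp)]
      simp
    have hBM := brunn_minkowski hl0 hl1 (hKc.inter_right (hcl S hS)) (hKc.inter_right (hcl T hT))
      (hKc.inter_right (hcl U hU)) fun x hx y hy =>
        ⟨hKv hx.1 hy.1 (by linarith) hl0.le (by ring), by
          have := h _ hx.2 _ hy.2
          rw [mem_ofPred_eq]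
          convert this using 1
          simp only [inner_sub_right, inner_add_right, inner_smul_right]
          ring⟩
    calc _ = (c ^ (1 - l) * c ^ l) * (volume.real (K ∩ {x | inner ℝ e (x - q) ∈ S}) ^ (1 - l) *
          volume.real (K ∩ {x | inner ℝ e (x - q) ∈ T}) ^ l) := by ring
      _ ≤ _ := by
        rw [hc]
        exact mul_le_mul_of_nonneg_left hBM (by positivity)
  constructor
  · intro x y l hl0 hl1
    refine key _ _ _ isClosed_Ici isClosed_Ici isClosed_Ici l hl0 hl1 fun s hs t ht => ?_
    exact add_le_add (mul_le_mul_of_nonneg_left hs (by linarith))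
      (mul_le_mul_of_nonneg_left ht hl0.le)
  · intro x y l hl0 hl1
    refine key _ _ _ isClosed_Iic isClosed_Iic isClosed_Iic l hl0 hl1 fun s hs t ht => ?_
    exact add_le_add (mul_le_mul_of_nonneg_left hs (by linarith))
      (mul_le_mul_of_nonneg_left ht hl0.le)

lemma setIntegral_comp (hKc : IsCompact K) (hK : volume K ≠ 0) {h : ℝ → ℝ} (hh : Measurable h) :
    ∫ x in K, h (inner ℝ e (x - q)) = volume.real K * ∫ t, h t ∂lineDistribution K q e := by
  rw [lineDistribution, integral_map (by fun_prop) hh.aestronglyMeasurable,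
    ProbabilityTheory.cond, integral_smul_measure, ENNReal.toReal_inv, smul_eq_mul,
    ← measureReal_def, mul_inv_cancel_left₀]
  exact (ENNReal.toReal_pos hK hKc.measure_lt_top.ne).ne'

lemma le_real_apply {S : Set ℝ} (hKc : IsCompact K) (hK : volume K ≠ 0)
    (hS : MeasurableSet S) {a : ℝ}
    (h : a * volume.real K ≤ volume.real (K ∩ {x | inner ℝ e (x - q) ∈ S})) :
    a ≤ (lineDistribution K q e).real S := by
  have hpos : 0 < volume.real K := ENNReal.toReal_pos hK hKc.measure_lt_top.ne
  rwa [real_apply hKc hS, inv_mul_eq_div, le_div_iff₀ hpos]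

/-- Lower bound for the truncated geometric mean over a convex set of a polynomial depending only
on one linear coordinate. -/
lemma le_setIntegral_log_max_abs_eval (hKc : IsCompact K) (hKv : Convex ℝ K) (hK : volume K ≠ 0)
    (he : e ≠ 0) {p : Polynomial ℝ} {d : ℕ} (hd : p.natDegree ≤ d) {M : ℝ} (hM : 0 < M)
    (h : Real.exp (-1) * volume.real K ≤
      volume.real (K ∩ {x | M ≤ |p.eval (inner ℝ e (x - q))|})) {κ : ℝ} (hκ : 0 < κ) :
    volume.real K * (Real.log M - d * (1 + Real.log 4)) ≤
      ∫ x in K, Real.log (max |p.eval (inner ℝ e (x - q))| κ) := by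
  have := isProbabilityMeasure (q := q) (e := e) hKc hK
  have := nullSingletonClass (q := q) hKc he
  rw [setIntegral_comp (h := fun t => Real.log (max |p.eval t| κ)) hKc hK (by fun_prop)]
  refine mul_le_mul_of_nonneg_left ?_ measureReal_nonneg
  exact (hasLogConcaveTails hKc hKv).le_integral_log_max_abs_eval hd hM
    (le_real_apply hKc hK (measurableSet_le measurable_const (by fun_prop)) h) hκ

/-- Upper bound for the truncated geometric mean over a convex set of a polynomial depending only
on one linear coordinate. -/
lemma setIntegral_log_max_abs_eval_le (hKc : IsCompact K) (hKv : Convex ℝ K) (hK : volume K ≠ 0)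
    (he : e ≠ 0) {p : Polynomial ℝ} {d : ℕ} (hd : p.natDegree ≤ d) {M : ℝ} (hM : 0 < M)
    (h : (1 - Real.exp (-1)) * volume.real K ≤
      volume.real (K ∩ {x | |p.eval (inner ℝ e (x - q))| ≤ M})) :
    ∫ x in K, Real.log (max |p.eval (inner ℝ e (x - q))| M) ≤
      volume.real K * (Real.log M + d * Real.log 12) := by
  have := isProbabilityMeasure (q := q) (e := e) hKc hK
  have := nullSingletonClass (q := q) hKc he
  rw [setIntegral_comp (h := fun t => Real.log (max |p.eval t| M)) hKc hK (by fun_prop)]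
  refine mul_le_mul_of_nonneg_left ?_ measureReal_nonneg
  exact (hasLogConcaveTails hKc hKv).integral_log_max_abs_eval_le hd hM
    (le_real_apply hKc hK (measurableSet_le (by fun_prop) measurable_const) h)

end lineDistribution

/-- The restriction of a polynomial to a line is a univariate polynomial. -/
lemma exists_polynomial_eval_line {n d : ℕ} {P : MvPolynomial (Fin n) ℝ} (hPd : P.totalDegree ≤ d)
    (q e : EuclideanSpace ℝ (Fin n)) : ∃ p : Polynomial ℝ, p.natDegree ≤ d ∧
      ∀ t : ℝ, p.eval t = MvPolynomial.eval (fun i => (q + t • e) i) P := by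
  refine ⟨MvPolynomial.aeval (fun i => Polynomial.C (e i) * Polynomial.X + Polynomial.C (q i)) P,
    (MvPolynomial.aeval_natDegree_le P hPd _ fun i => Polynomial.natDegree_linear_le).trans_eq
      (mul_one d), fun t => ?_⟩
  rw [← Polynomial.coe_evalRingHom, MvPolynomial.map_aeval, MvPolynomial.eval]
  congr 2
  · ext
    simp
  · ext i
    simp
    ring

lemma continuous_eval_coe {n : ℕ} (P : MvPolynomial (Fin n) ℝ) :
    Continuous fun x : EuclideanSpace ℝ (Fin n) => MvPolynomial.eval (fun i => x i) P :=
  P.continuous_eval.comp (by fun_prop)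

lemma log_le_log_add_div {X Y m ω : ℝ} (hX : 0 < X) (hm : 0 < m) (hmY : m ≤ Y) (hω : 0 ≤ ω)
    (h : X ≤ Y + ω) : Real.log X ≤ Real.log Y + ω / m := by
  have hY : 0 < Y := hm.trans_le hmY
  have h1 := Real.log_le_sub_one_of_pos (div_pos hX hY)
  rw [Real.log_div hX.ne' hY.ne'] at h1
  have h2 : X / Y - 1 ≤ ω / m := by
    calc X / Y - 1 = (X - Y) / Y := by field_simp
      _ ≤ ω / Y := by gcongr; linarith
      _ ≤ ω / m := by gcongr
  linarith

open Set Filter Topology in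
/-- Localization towards a set on which a given polynomial depends, approximately, on only one
linear coordinate. -/
lemma IsNeedleCandidate.exists_approx {n d : ℕ} (hn : 0 < n)
    {f g : EuclideanSpace ℝ (Fin n) → ℝ} {F : Set (EuclideanSpace ℝ (Fin n))}
    (hF : IsNeedleCandidate f g F) {P : MvPolynomial (Fin n) ℝ} (hPd : P.totalDegree ≤ d)
    {ω : ℝ} (hω : 0 < ω) :
    ∃ K ⊆ F, IsNeedleCandidate f g K ∧ volume K ≠ 0 ∧
      ∃ q e : EuclideanSpace ℝ (Fin n), e ≠ 0 ∧ ∃ p : Polynomial ℝ, p.natDegree ≤ d ∧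
        ∀ x ∈ K, |MvPolynomial.eval (fun i => x i) P - p.eval (inner ℝ e (x - q))| < ω := by
  have hu := hF.isCompact.uniformContinuousAt_of_continuousAt _
    (fun x _ => (continuous_eval_coe P).continuousAt) (Metric.dist_mem_uniformity hω)
  obtain ⟨ε, hε, hu⟩ := Metric.mem_uniformity_dist.1 hu
  obtain ⟨K, hKF, hK, q, e, he, hqe⟩ := hF.exists_thin hn hε
  obtain ⟨p, hpd, hp⟩ := exists_polynomial_eval_line hPd q e
  refine ⟨K, hKF, hK, fun h => ?_, q, e, norm_ne_zero_iff.1 (by simp [he]), p, hpd,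
    fun x hx => ?_⟩
  · have := hK.integral_neg
    rw [Measure.restrict_eq_zero.2 h, integral_zero_measure] at this
    exact lt_irrefl _ this
  · rw [hp]
    exact hu (hqe x hx) (hKF hx)

section Truncated

open Set Filter Topology

variable {n d : ℕ} {P : MvPolynomial (Fin n) ℝ} {F : Set (EuclideanSpace ℝ (Fin n))} {M : ℝ}

lemma integrableOn_log_max_abs_eval (P : MvPolynomial (Fin n) ℝ) (hF : IsCompact F) {κ : ℝ}
    (hκ : 0 < κ) :
    IntegrableOn (fun x => Real.log (max |MvPolynomial.eval (fun i => x i) P| κ)) F := by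
  refine (Continuous.continuousOn ?_).integrableOn_compact hF
  exact ((continuous_eval_coe P).abs.max continuous_const).log
    fun x => (lt_max_of_lt_right hκ).ne'

lemma setIntegral_indicator_sub_const {K S : Set (EuclideanSpace ℝ (Fin n))} (hK : IsCompact K)
    (hS : MeasurableSet S) (a : ℝ) :
    IntegrableOn (fun x => indicator S (fun _ => (1 : ℝ)) x - a) K ∧
      ∫ x in K, (indicator S (fun _ => (1 : ℝ)) x - a) =
        volume.real (K ∩ S) - a * volume.real K := by
  have hc : ∀ c : ℝ, IntegrableOn (fun _ : EuclideanSpace ℝ (Fin n) => c) K :=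
    fun c => integrableOn_const hK.measure_lt_top.ne
  refine ⟨((hc 1).indicator hS).sub (hc a), ?_⟩
  rw [integral_sub ((hc 1).indicator hS) (hc a), setIntegral_indicator hS]
  simp [mul_comm]

/-- Lower bound for the truncated geometric mean. -/
lemma le_setIntegral_log_max_abs_eval (hn : 0 < n) (hPd : P.totalDegree ≤ d) (hFcomp : IsCompact F)
    (hFconv : Convex ℝ F) (hFvol : volume.real F = 1) (hM : 0 < M)
    (hMdef : volume.real (F ∩ {x | M ≤ |MvPolynomial.eval (fun i => x i) P|}) = Real.exp (-1))
    {κ : ℝ} (hκ : 0 < κ) :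
    Real.log M - d * (1 + Real.log 4) ≤
      ∫ x in F, Real.log (max |MvPolynomial.eval (fun i => x i) P| κ) := by
  set Q : EuclideanSpace ℝ (Fin n) → ℝ := fun x => MvPolynomial.eval (fun i => x i) P with hQ
  have hQc : Continuous Q := continuous_eval_coe P
  have hS : MeasurableSet {x | M ≤ |Q x|} := measurableSet_le measurable_const (by fun_prop)
  by_contra! hlt
  set B := Real.log M - d * (1 + Real.log 4) with hB
  set η := (B - ∫ x in F, Real.log (max |Q x| κ)) / 2 with hη
  have hη0 : 0 < η := by rw [hη]; linarith
  have hc : ∀ (c : ℝ) {K}, IsCompact K →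
      IntegrableOn (fun _ : EuclideanSpace ℝ (Fin n) => c) K :=
    fun c K hK => integrableOn_const hK.measure_lt_top.ne
  have hgint : ∀ {K}, IsCompact K → ∫ x in K, (Real.log (max |Q x| κ) - (B - η)) =
      (∫ x in K, Real.log (max |Q x| κ)) - volume.real K * (B - η) := by
    intro K hK
    rw [integral_sub (integrableOn_log_max_abs_eval P hK hκ) (hc _ hK)]
    simp [hQ]
  obtain ⟨hf1, hf2⟩ := setIntegral_indicator_sub_const hFcomp hS (Real.exp (-1))
  have hcand : IsNeedleCandidate (fun x => indicator {x | M ≤ |Q x|} (fun _ => (1 : ℝ)) x -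
      Real.exp (-1)) (fun x => Real.log (max |Q x| κ) - (B - η)) F := by
    refine ⟨hFcomp, hFconv, hf1, (integrableOn_log_max_abs_eval P hFcomp hκ).sub (hc _ hFcomp),
      by rw [hf2, hMdef, hFvol]; ring, ?_⟩
    rw [hgint hFcomp, hFvol]
    linarith
  set ω := min (M / 2) (min (η * κ / 2) (η * M / 4)) with hω
  have hω0 : 0 < ω := by positivity
  have hωM : ω ≤ M / 2 := min_le_left _ _
  have hω1 : ω / κ ≤ η / 2 := by
    rw [div_le_iff₀ hκ]
    linarith [(min_le_right (M / 2) _).trans (min_le_left (η * κ / 2) (η * M / 4))]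
  have hω2 : ω / (M / 2) ≤ η / 2 := by
    rw [div_le_iff₀ (by positivity)]
    linarith [(min_le_right (M / 2) _).trans (min_le_right (η * κ / 2) (η * M / 4))]
  obtain ⟨K, hKF, hK, hK0, q, e, he, p, hpd, hp⟩ := hcand.exists_approx hn hPd hω0
  have hKc := hK.isCompact
  have hfK := hK.integral_eq_zero
  rw [(setIntegral_indicator_sub_const hKc hS _).2, sub_eq_zero] at hfK
  have hline := lineDistribution.le_setIntegral_log_max_abs_eval hKc hK.convex hK0 he hpd
    (M := M - ω) (q := q) (by linarith) (hfK ▸ measureReal_mono (fun x hx => ⟨hx.1, by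
      have h1 : M ≤ |Q x| := hx.2
      have h2 := abs_sub_abs_le_abs_sub (Q x) (p.eval (inner ℝ e (x - q)))
      have h3 := hp x hx.1
      rw [mem_ofPred_eq]
      linarith⟩) (measure_ne_top_of_subset inter_subset_left hKc.measure_lt_top.ne)) hκ
  have hlog : Real.log M ≤ Real.log (M - ω) + ω / (M / 2) :=
    log_le_log_add_div hM (by positivity) (by linarith) hω0.le (by linarith)
  have hpc : Continuous fun x => Real.log (max |p.eval (inner ℝ e (x - q))| κ) :=
    Continuous.log (by fun_prop) fun x => (lt_max_of_lt_right hκ).ne'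
  have hmono : ∫ x in K, Real.log (max |p.eval (inner ℝ e (x - q))| κ) ≤
      ∫ x in K, (Real.log (max |Q x| κ) + ω / κ) := by
    refine setIntegral_mono_on (hpc.continuousOn.integrableOn_compact hKc)
      ((integrableOn_log_max_abs_eval P hKc hκ).add (hc _ hKc)) hKc.measurableSet fun x hx => ?_
    refine log_le_log_add_div (lt_max_of_lt_right hκ) hκ (le_max_right _ _) hω0.le ?_
    have h2 := abs_sub_abs_le_abs_sub (p.eval (inner ℝ e (x - q))) (Q x)
    have h3 := hp x hx
    rw [abs_sub_comm] at h3
    refine max_le ?_ (by linarith [le_max_right |Q x| κ])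
    linarith [le_max_left |Q x| κ]
  rw [integral_add (integrableOn_log_max_abs_eval P hKc hκ) (hc _ hKc)] at hmono
  have hneg := hK.integral_neg
  rw [hgint hKc] at hneg
  simp only [integral_const, measureReal_restrict_apply_univ, smul_eq_mul] at hmono
  have hpos : 0 ≤ volume.real K := measureReal_nonneg
  have h1 : volume.real K * (B - η) ≤
      volume.real K * (Real.log (M - ω) - d * (1 + Real.log 4) - ω / κ) := by
    refine mul_le_mul_of_nonneg_left ?_ hpos
    linarith
  linarith

/-- Upper bound for the truncated geometric mean. -/
lemma setIntegral_log_max_abs_eval_le (hn : 0 < n) (hPd : P.totalDegree ≤ d) (hFcomp : IsCompact F)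
    (hFconv : Convex ℝ F) (hFvol : volume.real F = 1) (hM : 0 < M)
    (hMdef : volume.real (F ∩ {x | M ≤ |MvPolynomial.eval (fun i => x i) P|}) = Real.exp (-1)) :
    ∫ x in F, Real.log (max |MvPolynomial.eval (fun i => x i) P| M) ≤
      Real.log M + d * Real.log 12 := by
  set Q : EuclideanSpace ℝ (Fin n) → ℝ := fun x => MvPolynomial.eval (fun i => x i) P with hQ
  have hQc : Continuous Q := continuous_eval_coe P
  have hS : MeasurableSet {x | M ≤ |Q x|} := measurableSet_le measurable_const (by fun_prop)
  by_contra! hlt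
  set B := Real.log M + d * Real.log 12 with hB
  set η := ((∫ x in F, Real.log (max |Q x| M)) - B) / 2 with hη
  have hη0 : 0 < η := by rw [hη]; linarith
  have hc : ∀ (c : ℝ) {K}, IsCompact K →
      IntegrableOn (fun _ : EuclideanSpace ℝ (Fin n) => c) K :=
    fun c K hK => integrableOn_const hK.measure_lt_top.ne
  have hgint : ∀ {K}, IsCompact K → ∫ x in K, ((B + η) - Real.log (max |Q x| M)) =
      volume.real K * (B + η) - ∫ x in K, Real.log (max |Q x| M) := by
    intro K hK
    rw [integral_sub (hc _ hK) (integrableOn_log_max_abs_eval P hK hM)]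
    simp [hQ]
  obtain ⟨hf1, hf2⟩ := setIntegral_indicator_sub_const hFcomp hS (Real.exp (-1))
  have hcand : IsNeedleCandidate (fun x => indicator {x | M ≤ |Q x|} (fun _ => (1 : ℝ)) x -
      Real.exp (-1)) (fun x => (B + η) - Real.log (max |Q x| M)) F := by
    refine ⟨hFcomp, hFconv, hf1, (hc _ hFcomp).sub (integrableOn_log_max_abs_eval P hFcomp hM),
      by rw [hf2, hMdef, hFvol]; ring, ?_⟩
    rw [hgint hFcomp, hFvol]
    linarith
  set ω := η * M / 2 with hω
  have hω0 : 0 < ω := by positivity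
  have hω1 : ω / M = η / 2 := by
    rw [hω]
    field_simp
  obtain ⟨K, hKF, hK, hK0, q, e, he, p, hpd, hp⟩ := hcand.exists_approx hn hPd hω0
  have hKc := hK.isCompact
  have hfK := hK.integral_eq_zero
  rw [(setIntegral_indicator_sub_const hKc hS _).2, sub_eq_zero] at hfK
  have hdiff : volume.real (K \ {x | M ≤ |Q x|}) = (1 - Real.exp (-1)) * volume.real K := by
    have := measureReal_inter_add_sdiff (μ := volume) (s := K) hS hKc.measure_lt_top.ne
    linarith
  have hline := lineDistribution.setIntegral_log_max_abs_eval_le hKc hK.convex hK0 he hpd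
    (M := M + ω) (q := q) (by linarith) (hdiff ▸ measureReal_mono (fun x hx => ⟨hx.1, by
      have h1 : |Q x| < M := not_le.1 hx.2
      have h2 := abs_sub_abs_le_abs_sub (p.eval (inner ℝ e (x - q))) (Q x)
      have h3 := hp x hx.1
      rw [abs_sub_comm] at h3
      rw [mem_ofPred_eq]
      linarith⟩) (measure_ne_top_of_subset inter_subset_left hKc.measure_lt_top.ne))
  have hlog : Real.log (M + ω) ≤ Real.log M + ω / M :=
    log_le_log_add_div (by positivity) hM le_rfl hω0.le le_rfl
  have hpc : Continuous fun x => Real.log (max |p.eval (inner ℝ e (x - q))| (M + ω)) :=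
    Continuous.log (by fun_prop) fun x => (lt_max_of_lt_right (by positivity)).ne'
  have hpi := hpc.continuousOn.integrableOn_compact hKc (μ := volume)
  have hmono : ∫ x in K, Real.log (max |Q x| M) ≤
      ∫ x in K, (Real.log (max |p.eval (inner ℝ e (x - q))| (M + ω)) + ω / M) := by
    refine setIntegral_mono_on (integrableOn_log_max_abs_eval P hKc hM)
      (hpi.add (hc _ hKc)) hKc.measurableSet fun x hx => ?_
    have h0 := le_max_right |p.eval (inner ℝ e (x - q))| (M + ω)
    refine log_le_log_add_div (lt_max_of_lt_right hM) hM (by linarith) hω0.le ?_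
    have h2 := abs_sub_abs_le_abs_sub (Q x) (p.eval (inner ℝ e (x - q)))
    have h3 := hp x hx
    refine max_le ?_ (by linarith)
    linarith [le_max_left |p.eval (inner ℝ e (x - q))| (M + ω)]
  rw [integral_add hpi (hc _ hKc)] at hmono
  have hneg := hK.integral_neg
  rw [hgint hKc] at hneg
  simp only [integral_const, measureReal_restrict_apply_univ, smul_eq_mul] at hmono
  have hpos : 0 ≤ volume.real K := measureReal_nonneg
  have h1 : volume.real K * (Real.log (M + ω) + d * Real.log 12 + ω / M) ≤
      volume.real K * (B + η) := by
    refine mul_le_mul_of_nonneg_left ?_ hpos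
    linarith
  linarith

end Truncated

/-- A nonnegative bounded function whose truncated logarithms have integrals bounded below is almost
everywhere nonzero, and its logarithm is integrable with the same lower bound. -/
lemma integrable_log_of_forall_le_integral_log_max {α : Type*} [MeasurableSpace α] {μ : Measure α}
    [IsProbabilityMeasure μ] {u : α → ℝ} (hu : Measurable u) (hu0 : ∀ x, 0 ≤ u x) {B L : ℝ}
    (hB : 0 ≤ B) (hub : ∀ᵐ x ∂μ, u x ≤ Real.exp B)
    (hL : ∀ κ : ℝ, 0 < κ → L ≤ ∫ x, Real.log (max (u x) κ) ∂μ) :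
    (∀ᵐ x ∂μ, u x ≠ 0) ∧ Integrable (fun x => Real.log (u x)) μ ∧
      L ≤ ∫ x, Real.log (u x) ∂μ := by
  classical
  set v : ℕ → α → ℝ := fun k x => Real.log (max (u x) (Real.exp (-k))) with hv
  have hpos : ∀ (k : ℕ) x, 0 < max (u x) (Real.exp (-k)) := fun k x =>
    lt_max_of_lt_right (Real.exp_pos _)
  have hvm : ∀ k, Measurable (v k) := fun k => by fun_prop
  have hvB : ∀ k, ∀ᵐ x ∂μ, v k x ≤ B := fun k => by
    filter_upwards [hub] with x hx
    rw [hv, Real.log_le_iff_le_exp (hpos k x)]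
    exact max_le hx (Real.exp_le_exp.2 (by linarith [k.cast_nonneg (α := ℝ)]))
  have hvk : ∀ (k : ℕ) x, -(k : ℝ) ≤ v k x := fun k x => by
    rw [hv, Real.le_log_iff_exp_le (hpos k x)]
    exact le_max_right _ _
  have hvi : ∀ k, Integrable (v k) μ := fun k => by
    refine Integrable.of_bound (hvm k).aestronglyMeasurable (B + k) ?_
    filter_upwards [hvB k] with x hx
    rw [Real.norm_eq_abs, abs_le]
    constructor <;> linarith [hvk k x, k.cast_nonneg (α := ℝ)]
  set h : α → ENNReal := fun x => if u x = 0 then ⊤ else ENNReal.ofReal (B - Real.log (u x)) with hh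
  have hlim : Filter.Tendsto (fun k : ℕ => ∫⁻ x, ENNReal.ofReal (B - v k x) ∂μ) Filter.atTop
      (nhds (∫⁻ x, h x ∂μ)) := by
    refine lintegral_tendsto_of_tendsto_of_monotone (fun k => by fun_prop)
      (.of_forall fun x i j hij => ENNReal.ofReal_le_ofReal ?_) (.of_forall fun x => ?_)
    · have : v j x ≤ v i x := Real.log_le_log (hpos j x)
        (max_le_max le_rfl (Real.exp_le_exp.2 (by simpa using hij)))
      linarith
    · by_cases hx : u x = 0
      · simp only [hh, hx, if_true]
        refine ENNReal.tendsto_ofReal_nhds_top.2 ?_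
        have : ∀ k : ℕ, B - v k x = B + k := fun k => by
          simp [hv, hx, (Real.exp_pos _).le]
        simp only [this]
        exact Filter.tendsto_atTop_add_const_left _ _ tendsto_natCast_atTop_atTop
      · simp only [hh, hx, if_false]
        refine tendsto_const_nhds.congr' ?_
        have hx0 : 0 < u x := (hu0 x).lt_of_ne' hx
        filter_upwards [Filter.eventually_ge_atTop ⌈-Real.log (u x)⌉₊] with k hk
        have : Real.exp (-k) ≤ u x := by
          rw [← Real.le_log_iff_exp_le hx0]
          linarith [Nat.ceil_le.1 hk]
        simp only [hv, max_eq_left this]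
  have hle : ∫⁻ x, h x ∂μ ≤ ENNReal.ofReal (B - L) := by
    refine le_of_tendsto' hlim fun k => ?_
    have hi : Integrable (fun x => B - v k x) μ := (integrable_const B).sub (hvi k)
    rw [← ofReal_integral_eq_lintegral_ofReal hi
      (by filter_upwards [hvB k] with x hx using sub_nonneg.2 hx)]
    refine ENNReal.ofReal_le_ofReal ?_
    rw [integral_sub (integrable_const B) (hvi k)]
    simp only [integral_const, probReal_univ, smul_eq_mul, one_mul]
    exact sub_le_sub_left (hL _ (Real.exp_pos (-k))) B
  have hhm : Measurable h := Measurable.ite (hu (measurableSet_singleton 0)) measurable_const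
    (by fun_prop)
  have hne : ∀ᵐ x ∂μ, u x ≠ 0 := by
    filter_upwards [ae_lt_top hhm (hle.trans_lt ENNReal.ofReal_lt_top).ne] with x hx h0
    simp [hh, h0] at hx
  have hheq : ∫⁻ x, h x ∂μ = ∫⁻ x, ENNReal.ofReal (B - Real.log (u x)) ∂μ :=
    lintegral_congr_ae (by filter_upwards [hne] with x hx using by simp [hh, hx])
  have hnn : 0 ≤ᵐ[μ] fun x => B - Real.log (u x) := by
    filter_upwards [hne, hub] with x hx hx'
    exact sub_nonneg.2 ((Real.log_le_iff_le_exp ((hu0 x).lt_of_ne' hx)).2 hx')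
  have hm : Measurable fun x => B - Real.log (u x) := by fun_prop
  have hint : Integrable (fun x => B - Real.log (u x)) μ := by
    refine ⟨hm.aestronglyMeasurable, ?_⟩
    rw [hasFiniteIntegral_iff_ofReal hnn, ← hheq]
    exact hle.trans_lt ENNReal.ofReal_lt_top
  have hlog : Integrable (fun x => Real.log (u x)) μ := by
    refine ((integrable_const B).sub hint).congr (.of_forall fun x => ?_)
    simp
  refine ⟨hne, hlog, ?_⟩
  have h0 : L ≤ B := (hL _ (Real.exp_pos (-(0 : ℕ)))).trans <| by
    simpa [hv] using integral_mono_ae (hvi 0) (integrable_const B) (hvB 0)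
  rw [hheq, ← ofReal_integral_eq_lintegral_ofReal hint hnn,
    ENNReal.ofReal_le_ofReal_iff (sub_nonneg.2 h0), integral_sub (integrable_const B) hlog] at hle
  simp only [integral_const, probReal_univ, smul_eq_mul, one_mul] at hle
  linarith

/-- The geometric mean: `(4e)^{-d} M(P) ≤ exp(∫_F log|P|) ≤ 12^d M(P)`. -/
theorem geometric_mean_estimate {n : ℕ} (d : ℕ) (P : MvPolynomial (Fin n) ℝ)
    (hPd : P.totalDegree ≤ d) (hPnc : ∀ c : ℝ, P ≠ MvPolynomial.C c)
    (F : Set (EuclideanSpace ℝ (Fin n))) (hFcomp : IsCompact F) (hFconv : Convex ℝ F)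
    (hFvol : volume F = 1)
    (M : ℝ) (hM : 0 < M)
    (hMdef : volume {x ∈ F | M ≤ |MvPolynomial.eval (fun i => x i) P|} =
      ENNReal.ofReal (Real.exp (-1))) :
    ((4 * Real.exp 1) ^ d)⁻¹ * M ≤
        Real.exp (∫ x in F, Real.log |MvPolynomial.eval (fun i => x i) P|) ∧
      Real.exp (∫ x in F, Real.log |MvPolynomial.eval (fun i => x i) P|) ≤
        12 ^ d * M := by
  have hn : 0 < n := by
    rcases Nat.eq_zero_or_pos n with rfl | hn
    · exact absurd (MvPolynomial.eq_C_of_isEmpty P) (hPnc _)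
    · exact hn
  have hFvol' : volume.real F = 1 := by simp [Measure.real, hFvol]
  have hMdef' : volume.real (F ∩ {x | M ≤ |MvPolynomial.eval (fun i => x i) P|}) =
      Real.exp (-1) := by
    rw [Measure.real, show F ∩ {x | M ≤ |MvPolynomial.eval (fun i => x i) P|} = _ from rfl]
    exact (congrArg ENNReal.toReal hMdef).trans (ENNReal.toReal_ofReal (Real.exp_pos _).le)
  have hQc := continuous_eval_coe P
  have : IsProbabilityMeasure (volume.restrict F) := ⟨by simpa using hFvol⟩
  obtain ⟨C, hC⟩ := hFcomp.exists_bound_of_continuousOn hQc.continuousOn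
  have hC1 : 0 < max C 1 := lt_max_of_lt_right one_pos
  obtain ⟨hne, hint, hlow⟩ := integrable_log_of_forall_le_integral_log_max (μ := volume.restrict F)
    (u := fun x => |MvPolynomial.eval (fun i => x i) P|) hQc.abs.measurable
    (fun x => abs_nonneg _) (B := Real.log (max C 1)) (Real.log_nonneg (le_max_right _ _))
    ((ae_restrict_iff' hFcomp.measurableSet).2 (.of_forall fun x hx => by
      rw [Real.exp_log hC1]
      exact (hC x hx).trans (le_max_left _ _)))
    (fun κ hκ => le_setIntegral_log_max_abs_eval hn hPd hFcomp hFconv hFvol' hM hMdef' hκ)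
  have hup := setIntegral_log_max_abs_eval_le hn hPd hFcomp hFconv hFvol' hM hMdef'
  have hle : ∫ x in F, Real.log |MvPolynomial.eval (fun i => x i) P| ≤
      ∫ x in F, Real.log (max |MvPolynomial.eval (fun i => x i) P| M) := by
    refine integral_mono_ae hint (integrableOn_log_max_abs_eval P hFcomp hM) ?_
    filter_upwards [hne] with x hx
    exact Real.log_le_log ((abs_nonneg _).lt_of_ne' hx) (le_max_left _ _)
  constructor
  · rw [← Real.log_le_iff_le_exp (by positivity), Real.log_mul (by positivity) hM.ne', Real.log_inv,
      Real.log_pow, Real.log_mul (by norm_num) (Real.exp_pos _).ne', Real.log_exp]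
    linarith
  · rw [← Real.le_log_iff_exp_le (by positivity), Real.log_mul (by positivity) hM.ne', Real.log_pow]
    linarith
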